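/- Every cubic (3-regular) graph G on n vertices that is not isomorphic to K_4, K_{3,3}, or the disjoint union of three copies of K_4 contains a spanning subgraph H such that for every k with 0 ≤ k ≤ 3, the number of vertices of degree k in H lies in {⌊n/4⌋, ⌈n/4⌉}. -/

import Mathlib

open SimpleGraph

/-- The degree of `v` in `H`, as the cardinality of its neighbor set. -/
noncomputable def nDeg {V : Type*} (H : SimpleGraph V) (v : V) : ℕ :=
  (H.neighborSet v).ncard

/-- The number of vertices of degree `k` in `H`. -/
noncomputable def degCount {V : Type*} (H : SimpleGraph V) (k : ℕ) : ℕ :=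
  {v | nDeg H v = k}.ncard

def K4 : SimpleGraph (Fin 4) := completeGraph (Fin 4)

def K33 : SimpleGraph (Fin 3 ⊕ Fin 3) := completeBipartiteGraph (Fin 3) (Fin 3)

/-- The disjoint union of `m` copies of `K₄`. -/
def unionK4 (m : ℕ) : SimpleGraph (Fin m × Fin 4) :=
  SimpleGraph.fromRel (fun p q => p.1 = q.1)

set_option linter.unusedSectionVars false

section Degree

variable {V : Type*} [Fintype V] {G H H' : SimpleGraph V} {S A B : Finset V} {a b v w : V}

lemma exists_adj_notMem (F : Finset V) (h : F.card < nDeg H v) : ∃ w, w ∉ F ∧ H.Adj v w := by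
  by_contra! hc
  have hsub : H.neighborSet v ⊆ (F : Set V) := fun w hw => by
    by_contra hwF
    exact hc w hwF hw
  have := Set.ncard_le_ncard hsub F.finite_toSet
  rw [Set.ncard_coe_finset] at this
  exact absurd h (not_lt.mpr this)

lemma card_le_nDeg (F : Finset V) (h : ∀ w ∈ F, H.Adj v w) : F.card ≤ nDeg H v := by
  rw [← Set.ncard_coe_finset]
  exact Set.ncard_le_ncard (fun w hw => h w hw) (Set.toFinite _)

lemma nDeg_mono (h : H ≤ G) (v : V) : nDeg H v ≤ nDeg G v :=
  Set.ncard_le_ncard (fun _ hw => h hw) (Set.toFinite _)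

lemma exists_adj (h : 0 < nDeg H v) : ∃ w, H.Adj v w := by
  obtain ⟨w, -, hw⟩ := exists_adj_notMem (∅ : Finset V) (by simpa using h)
  exact ⟨w, hw⟩

lemma exists_adj_ne (a : V) (h : 1 < nDeg H v) : ∃ w, w ≠ a ∧ H.Adj v w := by
  obtain ⟨w, h1, hw⟩ := exists_adj_notMem ({a} : Finset V) (by simpa using h)
  exact ⟨w, by simpa using h1, hw⟩

lemma exists_adj_ne_ne (a b : V) (h : 2 < nDeg H v) : ∃ w, w ≠ a ∧ w ≠ b ∧ H.Adj v w := by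
  classical
  obtain ⟨w, h1, hw⟩ := exists_adj_notMem ({a, b} : Finset V) (Finset.card_le_two.trans_lt h)
  simp only [Finset.mem_insert, Finset.mem_singleton, not_or] at h1
  exact ⟨w, h1.1, h1.2, hw⟩

lemma nDeg_pos (h : H.Adj v w) : 0 < nDeg H v :=
  (Set.ncard_pos (Set.toFinite _)).mpr ⟨w, h⟩

lemma eq_of_adj_of_nDeg_one (h : nDeg H v = 1) (ha : H.Adj v a) (hb : H.Adj v b) : a = b := by
  obtain ⟨c, hc⟩ := Set.ncard_eq_one.mp h
  have h1 : a ∈ H.neighborSet v := ha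
  have h2 : b ∈ H.neighborSet v := hb
  rw [hc] at h1 h2
  exact h1.trans h2.symm

lemma exists_adj_not_adj (h : nDeg H v < nDeg G v) :
    ∃ w, G.Adj v w ∧ ¬ H.Adj v w := by
  by_contra! hc
  have := Set.ncard_le_ncard (fun w hw => hc w hw : G.neighborSet v ⊆ H.neighborSet v)
    (Set.toFinite _)
  exact absurd h (not_lt.mpr this)

lemma adj_of_nDeg_eq (hle : H ≤ G) (h : nDeg H v = nDeg G v) (hw : G.Adj v w) : H.Adj v w := by
  have hsub : H.neighborSet v ⊆ G.neighborSet v := fun w hw => hle hw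
  have : H.neighborSet v = G.neighborSet v :=
    Set.eq_of_subset_of_ncard_le hsub h.ge (Set.toFinite _)
  have h2 : w ∈ G.neighborSet v := hw
  rwa [← this] at h2

lemma nDeg_sdiff (hle : H ≤ G) (v : V) : nDeg (G \ H) v = nDeg G v - nDeg H v := by
  have : (G \ H).neighborSet v = G.neighborSet v \ H.neighborSet v := by
    ext w; simp
  have hsub : H.neighborSet v ⊆ G.neighborSet v := fun w hw => hle hw
  rw [nDeg, this, Set.ncard_sdiff hsub (Set.toFinite _)]
  rfl

lemma exists_delete_edge (hab : H.Adj a b) : ∃ H' ≤ H,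
    (∀ x y, H'.Adj x y ↔ H.Adj x y ∧ ¬ (x = a ∧ y = b) ∧ ¬ (x = b ∧ y = a)) ∧
    nDeg H' a + 1 = nDeg H a ∧ nDeg H' b + 1 = nDeg H b ∧
    ∀ v, v ≠ a → v ≠ b → nDeg H' v = nDeg H v := by
  have key : ∀ x y, (H.deleteEdges {s(a, b)}).Adj x y ↔
      H.Adj x y ∧ ¬ (x = a ∧ y = b) ∧ ¬ (x = b ∧ y = a) := fun x y => by
    simp [SimpleGraph.deleteEdges_adj]
  refine ⟨H.deleteEdges {s(a, b)}, SimpleGraph.deleteEdges_le _, key, ?_, ?_, ?_⟩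
  · have : (H.deleteEdges {s(a, b)}).neighborSet a = H.neighborSet a \ {b} := by
      ext y
      have := hab.ne
      simp only [SimpleGraph.mem_neighborSet, key, Set.mem_sdiff, Set.mem_singleton_iff]
      grind
    rw [nDeg, this]
    exact Set.ncard_sdiff_singleton_add_one hab (Set.toFinite _)
  · have : (H.deleteEdges {s(a, b)}).neighborSet b = H.neighborSet b \ {a} := by
      ext y
      have := hab.ne
      simp only [SimpleGraph.mem_neighborSet, key, Set.mem_sdiff, Set.mem_singleton_iff]
      grind
    rw [nDeg, this]
    exact Set.ncard_sdiff_singleton_add_one hab.symm (Set.toFinite _)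
  · intro v hva hvb
    have : (H.deleteEdges {s(a, b)}).neighborSet v = H.neighborSet v := by
      ext y
      simp only [SimpleGraph.mem_neighborSet, key]
      grind
    rw [nDeg, this]
    rfl

lemma exists_insert_edge (hle : H ≤ G) (hab : G.Adj a b) (hn : ¬ H.Adj a b) : ∃ H' ≤ G,
    (∀ x y, H'.Adj x y ↔ H.Adj x y ∨ (x = a ∧ y = b) ∨ (x = b ∧ y = a)) ∧
    nDeg H' a = nDeg H a + 1 ∧ nDeg H' b = nDeg H b + 1 ∧
    ∀ v, v ≠ a → v ≠ b → nDeg H' v = nDeg H v := by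
  have key : ∀ x y, (H ⊔ SimpleGraph.edge a b).Adj x y ↔
      H.Adj x y ∨ (x = a ∧ y = b) ∨ (x = b ∧ y = a) := fun x y => by
    have := hab.ne
    simp only [SimpleGraph.sup_adj, SimpleGraph.edge_adj]
    grind
  refine ⟨H ⊔ SimpleGraph.edge a b, fun x y h => ?_, key, ?_, ?_, ?_⟩
  · rcases (key x y).mp h with h | ⟨rfl, rfl⟩ | ⟨rfl, rfl⟩
    exacts [hle h, hab, hab.symm]
  · have : (H ⊔ SimpleGraph.edge a b).neighborSet a = insert b (H.neighborSet a) := by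
      ext y
      have := hab.ne
      simp only [SimpleGraph.mem_neighborSet, key, Set.mem_insert_iff]
      grind
    rw [nDeg, this]
    exact Set.ncard_insert_of_notMem hn (Set.toFinite _)
  · have : (H ⊔ SimpleGraph.edge a b).neighborSet b = insert a (H.neighborSet b) := by
      ext y
      have := hab.ne
      simp only [SimpleGraph.mem_neighborSet, key, Set.mem_insert_iff]
      grind
    rw [nDeg, this]
    exact Set.ncard_insert_of_notMem (fun h => hn h.symm) (Set.toFinite _)
  · intro v hva hvb
    have : (H ⊔ SimpleGraph.edge a b).neighborSet v = H.neighborSet v := by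
      ext y
      simp only [SimpleGraph.mem_neighborSet, key]
      grind
    rw [nDeg, this]
    rfl

end Degree

section Count

variable {V : Type*} [Fintype V] {G H H' : SimpleGraph V} {S A B : Finset V} {a b v w : V}

open Classical in
/-- The number of vertices of `S` whose degree in `H` is `k`. -/
noncomputable def cnt (S : Finset V) (H : SimpleGraph V) (k : ℕ) : ℕ :=
  (S.filter fun v => nDeg H v = k).card

lemma exists_of_cnt_pos {k : ℕ} (h : 0 < cnt S H k) : ∃ v ∈ S, nDeg H v = k := by
  obtain ⟨v, hv⟩ := Finset.card_pos.mp h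
  exact ⟨v, by simpa using hv⟩

lemma cnt_congr {k : ℕ} (h : ∀ v ∈ S, nDeg H v = nDeg H' v) : cnt S H k = cnt S H' k := by
  classical
  unfold cnt
  congr 1
  exact Finset.filter_congr fun v hv => by rw [h v hv]

lemma cnt_union [DecidableEq V] (h : Disjoint A B) (k : ℕ) :
    cnt (A ∪ B) H k = cnt A H k + cnt B H k := by
  unfold cnt
  rw [Finset.filter_union, Finset.card_union_of_disjoint]
  exact Finset.disjoint_filter_filter h

lemma cnt_sum (h : ∀ v ∈ S, nDeg H v ≤ 3) :
    cnt S H 0 + cnt S H 1 + cnt S H 2 + cnt S H 3 = S.card := by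
  classical
  have := Finset.card_eq_sum_card_fiberwise (s := S) (t := Finset.range 4)
    (f := fun v => nDeg H v) (fun v hv => by have := h v hv; simp; omega)
  rw [this]
  simp [Finset.sum_range_succ, cnt]

/-- Changing the degrees of two vertices of `S` only. -/
lemma cnt_change (ha : a ∈ S) (hb : b ∈ S) (hab : a ≠ b)
    (h : ∀ v, v ≠ a → v ≠ b → nDeg H' v = nDeg H v) (k : ℕ) :
    cnt S H' k + (if nDeg H a = k then 1 else 0) + (if nDeg H b = k then 1 else 0) =
      cnt S H k + (if nDeg H' a = k then 1 else 0) + (if nDeg H' b = k then 1 else 0) := by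
  classical
  have key : ∀ K : SimpleGraph V, cnt S K k = cnt ((S.erase a).erase b) K k +
      (if nDeg K a = k then 1 else 0) + (if nDeg K b = k then 1 else 0) := by
    intro K
    unfold cnt
    simp only [Finset.card_filter]
    rw [← Finset.sum_erase_add S _ ha,
      ← Finset.sum_erase_add (S.erase a) _ (Finset.mem_erase.mpr ⟨hab.symm, hb⟩)]
    ring
  have h2 : cnt ((S.erase a).erase b) H' k = cnt ((S.erase a).erase b) H k :=
    cnt_congr fun v hv => by
      simp only [Finset.mem_erase] at hv
      exact h v hv.2.1 hv.1
  rw [key H', key H, h2]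
  ring

/-- The numbers of vertices of `S` of degrees `0`, `1`, `2`, `3` in `H`. -/
def HasCounts (S : Finset V) (H : SimpleGraph V) (c₀ c₁ c₂ c₃ : ℕ) : Prop :=
  cnt S H 0 = c₀ ∧ cnt S H 1 = c₁ ∧ cnt S H 2 = c₂ ∧ cnt S H 3 = c₃

/-- No edge of `G` leaves `S`. -/
def IsClosedIn (G : SimpleGraph V) (S : Finset V) : Prop :=
  ∀ v ∈ S, ∀ w, G.Adj v w → w ∈ S

/-- No nonempty union of components of `G` inside `S` is saturated by `H`. -/
def Unsaturated (G : SimpleGraph V) (S : Finset V) (H : SimpleGraph V) : Prop :=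
  ∀ W ⊆ S, W.Nonempty → IsClosedIn G W → ∃ v ∈ W, nDeg H v ≠ 3

lemma delete_edge (hle : H ≤ G) (hab : H.Adj a b) (ha : a ∈ S) (hb : b ∈ S) : ∃ H' ≤ G,
    (∀ x y, H'.Adj x y ↔ H.Adj x y ∧ ¬ (x = a ∧ y = b) ∧ ¬ (x = b ∧ y = a)) ∧
    nDeg H' a + 1 = nDeg H a ∧ nDeg H' b + 1 = nDeg H b ∧
    (∀ v, v = a ∨ v = b ∨ nDeg H' v = nDeg H v) ∧
    ∀ k, cnt S H' k + (if nDeg H a = k then 1 else 0) + (if nDeg H b = k then 1 else 0) =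
      cnt S H k + (if nDeg H' a = k then 1 else 0) + (if nDeg H' b = k then 1 else 0) := by
  obtain ⟨H', h1, h2, h3, h4, h5⟩ := exists_delete_edge hab
  exact ⟨H', h1.trans hle, h2, h3, h4, by grind, cnt_change ha hb hab.ne h5⟩

lemma insert_edge (hle : H ≤ G) (hab : G.Adj a b) (hn : ¬ H.Adj a b) (ha : a ∈ S) (hb : b ∈ S) :
    ∃ H' ≤ G, (∀ x y, H'.Adj x y ↔ H.Adj x y ∨ (x = a ∧ y = b) ∨ (x = b ∧ y = a)) ∧
    nDeg H' a = nDeg H a + 1 ∧ nDeg H' b = nDeg H b + 1 ∧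
    (∀ v, v = a ∨ v = b ∨ nDeg H' v = nDeg H v) ∧
    ∀ k, cnt S H' k + (if nDeg H a = k then 1 else 0) + (if nDeg H b = k then 1 else 0) =
      cnt S H k + (if nDeg H' a = k then 1 else 0) + (if nDeg H' b = k then 1 else 0) := by
  obtain ⟨H', h1, h2, h3, h4, h5⟩ := exists_insert_edge hle hab hn
  exact ⟨H', h1, h2, h3, h4, by grind, cnt_change ha hb hab.ne h5⟩

end Count

section Chain

variable {V : Type*} [Fintype V] {G H H' : SimpleGraph V} {S A B : Finset V} {a b v w : V}

/-- `S` has an unsaturated spanning subgraph with the given degree counts. -/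
def Reach (G : SimpleGraph V) (S : Finset V) (c₀ c₁ c₂ c₃ : ℕ) : Prop :=
  ∃ H ≤ G, Unsaturated G S H ∧ HasCounts S H c₀ c₁ c₂ c₃

lemma Unsaturated.of_forall (h : Unsaturated G S H)
    (h' : ∀ v ∈ S, nDeg H' v = 3 → nDeg H v = 3 ∨ ∃ u, G.Adj v u ∧ nDeg H' u ≠ 3) :
    Unsaturated G S H' := by
  intro W hW hne hcl
  obtain ⟨v, hv, h3⟩ := h W hW hne hcl
  by_cases hv' : nDeg H' v = 3
  · obtain hh | ⟨u, hu, hu3⟩ := h' v (hW hv) hv'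
    · exact absurd hh h3
    · exact ⟨u, hcl v hv u hu, hu3⟩
  · exact ⟨v, hv, hv'⟩

lemma exists_path_of_unsaturated (hG : ∀ v, nDeg G v = 3) (hle : H ≤ G) (hS : IsClosedIn G S)
    (hu : Unsaturated G S H) (ha : a ∈ S) (hab : H.Adj a b) (h3a : nDeg H a = 3)
    (h3b : nDeg H b = 3) :
    ∃ y x w, y ∈ S ∧ x ∈ S ∧ w ∈ S ∧ H.Adj y x ∧ H.Adj x w ∧ nDeg H y = 3 ∧ nDeg H x = 3 ∧
      nDeg H w ≠ 3 := by
  classical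
  by_contra! hc
  let W := S.filter fun x => nDeg H x = 3 ∧ ∃ y, H.Adj x y ∧ nDeg H y = 3
  have hmem : ∀ x, x ∈ W ↔ x ∈ S ∧ nDeg H x = 3 ∧ ∃ y, H.Adj x y ∧ nDeg H y = 3 := by
    intro x; simp [W]
  have hcl : IsClosedIn G W := by
    intro x hx u hxu
    obtain ⟨hxS, hx3, y, hxy, hy⟩ := (hmem x).mp hx
    have hxu' := adj_of_nDeg_eq hle (by rw [hx3, hG]) hxu
    have := hc y x u (hS x hxS y (hle hxy)) hxS (hS x hxS u hxu) hxy.symm hxu' hy hx3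
    exact (hmem u).mpr ⟨hS x hxS u hxu, this, x, hxu'.symm, hx3⟩
  obtain ⟨v, hv, h3⟩ := hu W (Finset.filter_subset _ _)
    ⟨a, (hmem a).mpr ⟨ha, h3a, b, hab, h3b⟩⟩ hcl
  exact h3 ((hmem v).mp hv).2.1

lemma card_le_of_adj (h : ∀ a ∈ A, ∃ b ∈ B, H.Adj a b)
    (huniq : ∀ b ∈ B, ∀ a ∈ A, ∀ a' ∈ A, H.Adj a b → H.Adj a' b → a = a') :
    A.card ≤ B.card := by
  choose! f hf hadj using h
  refine Finset.card_le_card_of_injOn f hf fun a ha a' ha' heq => ?_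
  exact huniq (f a) (hf a ha) a ha a' ha' (hadj a ha) (heq ▸ hadj a' ha')

lemma cnt_le_cnt {i j : ℕ} (hle : H ≤ G) (hS : IsClosedIn G S)
    (h : ∀ a ∈ S, nDeg H a = i → ∃ b, H.Adj a b ∧ nDeg H b = j)
    (huniq : ∀ b ∈ S, ∀ a a', nDeg H b = j → nDeg H a = i → nDeg H a' = i → H.Adj b a →
      H.Adj b a' → a = a') : cnt S H i ≤ cnt S H j := by
  classical
  refine card_le_of_adj (H := H) (fun a ha => ?_) fun b hb a ha a' ha' h1 h2 => ?_
  · simp only [Finset.mem_filter] at ha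
    obtain ⟨b, hab, hb⟩ := h a ha.1 ha.2
    exact ⟨b, by simpa using ⟨hS a ha.1 b (hle hab), hb⟩, hab⟩
  · simp only [Finset.mem_filter] at ha ha' hb
    exact huniq b hb.1 a a' hb.2 ha.2 ha'.2 h1.symm h2.symm

lemma cnt_le_cnt_add_one {i j : ℕ} (hle : H ≤ G) (hS : IsClosedIn G S) (x : V)
    (h : ∀ a ∈ S, a ≠ x → nDeg H a = i → ∃ b, H.Adj a b ∧ nDeg H b = j)
    (huniq : ∀ b ∈ S, ∀ a a', nDeg H b = j → nDeg H a = i → nDeg H a' = i → H.Adj b a →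
      H.Adj b a' → a = a') : cnt S H i ≤ cnt S H j + 1 := by
  classical
  have h1 : ((S.filter fun v => nDeg H v = i).erase x).card ≤
      (S.filter fun v => nDeg H v = j).card := by
    refine card_le_of_adj (H := H) (fun a ha => ?_) fun b hb a ha a' ha' h1 h2 => ?_
    · simp only [Finset.mem_filter, Finset.mem_erase] at ha
      obtain ⟨b, hab, hb⟩ := h a ha.2.1 ha.1 ha.2.2
      exact ⟨b, by simpa using ⟨hS a ha.2.1 b (hle hab), hb⟩, hab⟩
    · simp only [Finset.mem_filter, Finset.mem_erase] at ha ha' hb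
      exact huniq b hb.1 a a' hb.2 ha.2.2 ha'.2.2 h1.symm h2.symm
  have h2 := Finset.pred_card_le_card_erase (s := S.filter fun v => nDeg H v = i) (a := x)
  unfold cnt
  omega

/-- Deleting one edge. -/
lemma reach_delete_edge (hG : ∀ v, nDeg G v = 3) (hle : H ≤ G) (hu : Unsaturated G S H)
    (hS : IsClosedIn G S) (ha : a ∈ S) (hab : H.Adj a b) : ∃ H' ≤ G, Unsaturated G S H' ∧
    (∀ x y, H'.Adj x y ↔ H.Adj x y ∧ ¬ (x = a ∧ y = b) ∧ ¬ (x = b ∧ y = a)) ∧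
    nDeg H' a + 1 = nDeg H a ∧ nDeg H' b + 1 = nDeg H b ∧
    (∀ v, v ≠ a → v ≠ b → nDeg H' v = nDeg H v) ∧
    ∀ k, cnt S H' k + (if nDeg H a = k then 1 else 0) + (if nDeg H b = k then 1 else 0) =
      cnt S H k + (if nDeg H a = k + 1 then 1 else 0) + (if nDeg H b = k + 1 then 1 else 0) := by
  have hb := hS a ha b (hle hab)
  obtain ⟨H', h1, h2, h3, h4, h5, h6⟩ := delete_edge (S := S) hle hab ha hb
  refine ⟨H', h1, hu.of_forall ?_, h2, h3, h4, by grind, ?_⟩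
  · have hle3 : ∀ v, nDeg H v ≤ 3 := fun v => hG v ▸ nDeg_mono hle v
    intro v hv hv3
    left
    grind
  · grind

/-- Inserting an edge one of whose ends has degree at most one. -/
lemma reach_insert_edge (hle : H ≤ G) (hu : Unsaturated G S H)
    (hS : IsClosedIn G S) (ha : a ∈ S) (hab : G.Adj a b) (hn : ¬ H.Adj a b) (h1a : nDeg H a ≤ 1) :
    ∃ H' ≤ G, Unsaturated G S H' ∧
    (∀ x y, H'.Adj x y ↔ H.Adj x y ∨ (x = a ∧ y = b) ∨ (x = b ∧ y = a)) ∧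
    nDeg H' a = nDeg H a + 1 ∧ nDeg H' b = nDeg H b + 1 ∧
    (∀ v, v ≠ a → v ≠ b → nDeg H' v = nDeg H v) ∧
    ∀ k, cnt S H' k + (if nDeg H a = k then 1 else 0) + (if nDeg H b = k then 1 else 0) =
      cnt S H k + (if nDeg H a + 1 = k then 1 else 0) + (if nDeg H b + 1 = k then 1 else 0) := by
  have hb := hS a ha b hab
  obtain ⟨H', h1, h2, h3, h4, h5, h6⟩ := insert_edge (S := S) hle hab hn ha hb
  refine ⟨H', h1, hu.of_forall ?_, h2, h3, h4, by grind, ?_⟩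
  · intro v hv hv3
    by_cases hvb : v = b
    · exact Or.inr ⟨a, hvb ▸ hab.symm, by omega⟩
    · left
      grind
  · grind

/-- Inserting an edge both of whose ends have further unsaturated neighbors. -/
lemma reach_insert_edge_of_adj {p q : V} (hle : H ≤ G) (hu : Unsaturated G S H)
    (hS : IsClosedIn G S) (ha : a ∈ S) (hab : G.Adj a b) (hn : ¬ H.Adj a b)
    (hp : H.Adj a p) (hp3 : nDeg H p ≠ 3) (hq : H.Adj b q) (hq3 : nDeg H q ≠ 3) :
    ∃ H' ≤ G, Unsaturated G S H' ∧
    (∀ x y, H'.Adj x y ↔ H.Adj x y ∨ (x = a ∧ y = b) ∨ (x = b ∧ y = a)) ∧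
    nDeg H' a = nDeg H a + 1 ∧ nDeg H' b = nDeg H b + 1 ∧
    (∀ v, v ≠ a → v ≠ b → nDeg H' v = nDeg H v) ∧
    ∀ k, cnt S H' k + (if nDeg H a = k then 1 else 0) + (if nDeg H b = k then 1 else 0) =
      cnt S H k + (if nDeg H a + 1 = k then 1 else 0) + (if nDeg H b + 1 = k then 1 else 0) := by
  have hb := hS a ha b hab
  obtain ⟨H', h1, h2, h3, h4, h5, h6⟩ := insert_edge (S := S) hle hab hn ha hb
  have hpa := hp.ne
  have hqb := hq.ne
  have hpb : p ≠ b := fun h => hn (h ▸ hp)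
  have hqa : q ≠ a := fun h => hn (h ▸ hq).symm
  refine ⟨H', h1, hu.of_forall ?_, h2, h3, h4, by grind, ?_⟩
  · intro v hv hv3
    by_cases hva : v = a
    · exact Or.inr ⟨p, hva ▸ hle hp, by grind⟩
    by_cases hvb : v = b
    · exact Or.inr ⟨q, hvb ▸ hle hq, by grind⟩
    · left
      grind
  · grind

/-- Deleting two incident edges. -/
lemma reach_delete_path {x y : V} (hG : ∀ v, nDeg G v = 3) (hle : H ≤ G) (hu : Unsaturated G S H)
    (hS : IsClosedIn G S) (hx : x ∈ S) (hxy : H.Adj x y) (hxw : H.Adj x w)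
    (hyw : y ≠ w) : ∃ H' ≤ G, Unsaturated G S H' ∧
    ∀ k, cnt S H' k + (if nDeg H x = k then 1 else 0) + (if nDeg H y = k then 1 else 0) +
        (if nDeg H w = k then 1 else 0) =
      cnt S H k + (if nDeg H x = k + 2 then 1 else 0) + (if nDeg H y = k + 1 then 1 else 0) +
        (if nDeg H w = k + 1 then 1 else 0) := by
  have hy := hS x hx y (hle hxy)
  have hw := hS x hx w (hle hxw)
  have := hxy.ne
  have := hxw.ne
  obtain ⟨H₁, h1, h2, h3, h4, h5, h6⟩ := delete_edge (S := S) hle hxy hx hy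
  obtain ⟨H₂, g1, g2, g3, g4, g5, g6⟩ := delete_edge (S := S) h1
    (show H₁.Adj x w by grind) hx hw
  refine ⟨H₂, g1, hu.of_forall ?_, ?_⟩
  · have hle3 : ∀ v, nDeg H v ≤ 3 := fun v => hG v ▸ nDeg_mono hle v
    intro v hv hv3
    left
    grind
  · intro k
    have e1 := h6 k
    have e2 := g6 k
    have e3 : nDeg H₁ w = nDeg H w := by grind
    rw [e3] at e2 g4
    simp only [← h3, ← h4, ← g3, ← g4, Nat.add_right_cancel_iff] at *
    grind

end Chain

section ChainSteps

variable {V : Type*} [Fintype V] {G H H' : SimpleGraph V} {S A B : Finset V} {a b v w : V}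

set_option maxHeartbeats 1000000 in
lemma reach_C (hG : ∀ v, nDeg G v = 3) (hS : IsClosedIn G S) {m d : ℕ}
    (h : Reach G S (m + 1) m (m + 1) (d + 1)) (hd : m + 1 ≤ d) :
    Reach G S (m + 1) (m + 1) (m + 1) d := by
  obtain ⟨H, hle, hu, c0, c1, c2, c3⟩ := h
  have hle3 : ∀ v, nDeg H v ≤ 3 := fun v => hG v ▸ nDeg_mono hle v
  have hpos : ∀ a b, H.Adj a b → 0 < nDeg H a := fun a b hab => nDeg_pos hab
  have hsymm : ∀ a b, H.Adj a b → H.Adj b a := fun a b hab => hab.symm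
  have hne : ∀ a b, H.Adj a b → a ≠ b := fun a b hab => hab.ne
  have hSc : ∀ a b, a ∈ S → H.Adj a b → b ∈ S := fun a b ha hab => hS a ha b (hle hab)
  have huniq1 : ∀ v a b, nDeg H v = 1 → H.Adj v a → H.Adj v b → a = b :=
    fun v a b => eq_of_adj_of_nDeg_one
  by_cases h23 : ∃ a ∈ S, ∃ b, H.Adj a b ∧ nDeg H a = 2 ∧ nDeg H b = 3
  · obtain ⟨a, ha, b, hab, ha2, hb3⟩ := h23
    obtain ⟨H', l, u, -, -, -, -, k⟩ := reach_delete_edge hG hle hu hS ha hab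
    simp only [ha2, hb3] at k
    exact ⟨H', l, u, by grind [HasCounts], by grind, by grind, by grind⟩
  have h3nbr : ∀ a b, a ∈ S → H.Adj a b → nDeg H a = 3 → nDeg H b = 1 ∨ nDeg H b = 3 := by
    grind
  obtain ⟨a, ha, b, hab, ha3, hb3⟩ :
      ∃ a ∈ S, ∃ b, H.Adj a b ∧ nDeg H a = 3 ∧ nDeg H b = 3 := by
    by_contra! hc
    have := cnt_le_cnt (i := 3) (j := 1) hle hS (fun a ha ha3 => by
      obtain ⟨b, hb⟩ := exists_adj (H := H) (v := a) (by omega)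
      exact ⟨b, hb, by grind⟩) (fun b _ a a' hb _ _ => huniq1 b a a' hb)
    omega
  obtain ⟨y, x, w, hy, hx, hw, hyx, hxw, hy3, hx3, hw3⟩ :=
    exists_path_of_unsaturated hG hle hS hu ha hab ha3 hb3
  have hw1 : nDeg H w = 1 := by grind
  by_cases h02 : ∃ a ∈ S, ∃ b, G.Adj a b ∧ nDeg H a = 0 ∧ nDeg H b = 2
  · obtain ⟨a, ha, b, hab, ha0, hb2⟩ := h02
    obtain ⟨H₁, l₁, u₁, adj₁, da, db, d₁, k₁⟩ := reach_insert_edge hle hu hS ha hab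
      (fun h => by grind) (by omega)
    obtain ⟨H', l, u, k⟩ := reach_delete_path hG l₁ u₁ hS hx (show H₁.Adj x y by grind)
      (show H₁.Adj x w by grind) (by grind)
    have e1 : nDeg H₁ x = 3 := (d₁ _ (by grind) (by grind)).trans hx3
    have e2 : nDeg H₁ y = 3 := (d₁ _ (by grind) (by grind)).trans hy3
    have e3 : nDeg H₁ w = 1 := (d₁ _ (by grind) (by grind)).trans hw1
    simp only [e1, e2, e3] at k
    simp only [ha0, hb2] at k₁
    exact ⟨H', l, u,
      by have a := k 0; have b := k₁ 0; simp at a b; omega,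
      by have a := k 1; have b := k₁ 1; simp at a b; omega,
      by have a := k 2; have b := k₁ 2; simp at a b; omega,
      by have a := k 3; have b := k₁ 3; simp at a b; omega⟩
  have h02 : ∀ a b, a ∈ S → G.Adj a b → nDeg H a = 0 → nDeg H b ≠ 2 := by grind
  obtain ⟨p, hp, q, hpq, hp2, hq2⟩ :
      ∃ p ∈ S, ∃ q, H.Adj p q ∧ nDeg H p = 2 ∧ nDeg H q = 2 := by
    by_contra! hc
    have := cnt_le_cnt (i := 2) (j := 1) hle hS (fun a ha ha2 => by
      obtain ⟨b, hb⟩ := exists_adj (H := H) (v := a) (by omega)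
      exact ⟨b, hb, by grind⟩) (fun b _ a a' hb _ _ => huniq1 b a a' hb)
    omega
  obtain ⟨t, hwt, hwt'⟩ := exists_adj_not_adj (H := H) (G := G) (v := w) (by grind)
  have ht := hS w hw t hwt
  have ht3 : nDeg H t ≠ 3 := fun h =>
    hwt' (adj_of_nDeg_eq hle (by rw [h, hG]) hwt.symm).symm
  have hwtne := hwt.ne
  have htx : t ≠ x := by grind
  obtain ⟨H₁, l₁, u₁, adj₁, da, db, d₁, k₁⟩ := reach_insert_edge hle hu hS hw hwt hwt' (by omega)
  by_cases ht2 : nDeg H t = 2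
  · obtain ⟨H', l, u, k⟩ := reach_delete_path hG l₁ u₁ hS hx (show H₁.Adj x y by grind)
      (show H₁.Adj x w by grind) (by grind)
    have e1 : nDeg H₁ x = 3 := (d₁ _ (by grind) (by grind)).trans hx3
    have e2 : nDeg H₁ y = 3 := (d₁ _ (by grind) (by grind)).trans hy3
    have e3 : nDeg H₁ w = 2 := by grind
    simp only [e1, e2, e3] at k
    simp only [hw1, ht2] at k₁
    exact ⟨H', l, u,
      by have a := k 0; have b := k₁ 0; simp at a b; omega,
      by have a := k 1; have b := k₁ 1; simp at a b; omega,
      by have a := k 2; have b := k₁ 2; simp at a b; omega,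
      by have a := k 3; have b := k₁ 3; simp at a b; omega⟩
  obtain ⟨H₂, l₂, u₂, adj₂, dx, dw, d₂, k₂⟩ := reach_delete_edge hG l₁ u₁ hS hx
    (show H₁.Adj x w by grind)
  have e1 : nDeg H₁ x = 3 := (d₁ _ (by grind) (by grind)).trans hx3
  have e2 : nDeg H₁ w = 2 := by grind
  simp only [e1, e2] at k₂
  by_cases ht1 : nDeg H t = 1
  · obtain ⟨H', l, u, -, -, -, -, k⟩ := reach_delete_edge hG l₂ u₂ hS hp
      (show H₂.Adj p q by grind)
    have e3 : nDeg H₂ p = 2 :=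
      (d₂ _ (by grind) (by grind)).trans ((d₁ _ (by grind) (by grind)).trans hp2)
    have e4 : nDeg H₂ q = 2 :=
      (d₂ _ (by grind) (by grind)).trans ((d₁ _ (by grind) (by grind)).trans hq2)
    simp only [e3, e4] at k
    simp only [hw1, ht1] at k₁
    exact ⟨H', l, u,
      by have a := k 0; have b := k₁ 0; have c := k₂ 0; simp at a b c; omega,
      by have a := k 1; have b := k₁ 1; have c := k₂ 1; simp at a b c; omega,
      by have a := k 2; have b := k₁ 2; have c := k₂ 2; simp at a b c; omega,
      by have a := k 3; have b := k₁ 3; have c := k₂ 3; simp at a b c; omega⟩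
  have ht0 : nDeg H t = 0 := by have := hle3 t; omega
  by_cases h12 : ∃ a ∈ S, ∃ b, H.Adj a b ∧ nDeg H a = 1 ∧ nDeg H b = 2
  · obtain ⟨a, ha, b, hab, ha1, hb2⟩ := h12
    have haw : a ≠ w := by
      rintro rfl
      rw [huniq1 a b x ha1 hab hxw.symm] at hb2
      omega
    obtain ⟨H', l, u, -, -, -, -, k⟩ := reach_delete_edge hG l₂ u₂ hS ha
      (show H₂.Adj a b by grind)
    have e3 : nDeg H₂ a = 1 :=
      (d₂ _ (by grind) (by grind)).trans ((d₁ _ (by grind) (by grind)).trans ha1)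
    have e4 : nDeg H₂ b = 2 :=
      (d₂ _ (by grind) (by grind)).trans ((d₁ _ (by grind) (by grind)).trans hb2)
    simp only [e3, e4] at k
    simp only [hw1, ht0] at k₁
    exact ⟨H', l, u,
      by have a := k 0; have b := k₁ 0; have c := k₂ 0; simp at a b c; omega,
      by have a := k 1; have b := k₁ 1; have c := k₂ 1; simp at a b c; omega,
      by have a := k 2; have b := k₁ 2; have c := k₂ 2; simp at a b c; omega,
      by have a := k 3; have b := k₁ 3; have c := k₂ 3; simp at a b c; omega⟩
  have h2nbr : ∀ a b, a ∈ S → H.Adj a b → nDeg H a = 2 → nDeg H b = 2 := by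
    intro a b haS hab' ha2
    have := hpos b a (hsymm a b hab')
    have := hle3 b
    have : nDeg H b ≠ 1 := fun h => h12 ⟨b, hSc a b haS hab', a, hab'.symm, h, ha2⟩
    have : nDeg H b ≠ 3 := fun h => h23 ⟨a, haS, b, hab', ha2, h⟩
    omega
  obtain ⟨r, hpr, hpr'⟩ := exists_adj_not_adj (H := H) (G := G) (v := p) (by grind)
  have hr := hS p hp r hpr
  have hr3 : nDeg H r ≠ 3 := fun h =>
    hpr' (adj_of_nDeg_eq hle (by rw [h, hG]) hpr.symm).symm
  have hprne := hpr.ne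
  have hr0 : nDeg H r ≠ 0 := fun h => h02 r p hr hpr.symm h hp2
  have hq := hSc p q hp hpq
  by_cases hr1 : nDeg H r = 1
  · obtain ⟨q', hq'p, hqq'⟩ := exists_adj_ne (H := H) (v := q) p (by omega)
    have hq'2 := h2nbr q q' hq hqq' hq2
    obtain ⟨K₁, l₁, u₁, adj₁, da, db, d₁, k₁⟩ := reach_insert_edge hle hu hS hr hpr.symm
      (fun h => hpr' h.symm) (by omega)
    obtain ⟨K₂, l₂, u₂, adj₂, dx, dw, d₂, k₂⟩ := reach_delete_edge hG l₁ u₁ hS hq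
      (show K₁.Adj q q' by grind)
    obtain ⟨H', l, u, -, -, -, -, k⟩ := reach_delete_edge hG l₂ u₂ hS ha
      (show K₂.Adj a b by grind)
    have e1 : nDeg K₁ q = 2 := (d₁ _ (by grind) (by grind)).trans hq2
    have e2 : nDeg K₁ q' = 2 := (d₁ _ (by grind) (by grind)).trans hq'2
    have e3 : nDeg K₂ a = 3 :=
      (d₂ _ (by grind) (by grind)).trans ((d₁ _ (by grind) (by grind)).trans ha3)
    have e4 : nDeg K₂ b = 3 :=
      (d₂ _ (by grind) (by grind)).trans ((d₁ _ (by grind) (by grind)).trans hb3)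
    simp only [hr1, hp2] at k₁
    simp only [e1, e2] at k₂
    simp only [e3, e4] at k
    exact ⟨H', l, u,
      by have a := k 0; have b := k₁ 0; have c := k₂ 0; simp at a b c; omega,
      by have a := k 1; have b := k₁ 1; have c := k₂ 1; simp at a b c; omega,
      by have a := k 2; have b := k₁ 2; have c := k₂ 2; simp at a b c; omega,
      by have a := k 3; have b := k₁ 3; have c := k₂ 3; simp at a b c; omega⟩
  have hr2 : nDeg H r = 2 := by grind
  by_cases h31 : ∀ a ∈ S, nDeg H a = 3 → ∃ b, H.Adj a b ∧ nDeg H b = 1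
  · have := cnt_le_cnt (i := 3) (j := 1) hle hS h31 (fun b _ a a' hb _ _ => huniq1 b a a' hb)
    omega
  push Not at h31
  obtain ⟨x, hx, hx3, hx1⟩ := h31
  obtain ⟨y, hxy⟩ := exists_adj (H := H) (v := x) (by omega)
  obtain ⟨z, hzy, hxz⟩ := exists_adj_ne (H := H) (v := x) y (by omega)
  have hy3 : nDeg H y = 3 := by grind
  have hz3 : nDeg H z = 3 := by grind
  obtain ⟨q', hrq'⟩ := exists_adj (H := H) (v := r) (by omega)
  obtain ⟨K₁, l₁, u₁, adj₁, da, db, d₁, k₁⟩ := reach_insert_edge_of_adj hle hu hS hp hpr hpr'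
    hpq (by omega) hrq' (by rw [h2nbr r q' hr hrq' hr2]; omega)
  obtain ⟨H', l, u, k⟩ := reach_delete_path hG l₁ u₁ hS hx (show K₁.Adj x y by grind)
      (show K₁.Adj x z by grind) (by grind)
  have e1 : nDeg K₁ x = 3 := (d₁ _ (by grind) (by grind)).trans hx3
  have e2 : nDeg K₁ y = 3 := (d₁ _ (by grind) (by grind)).trans hy3
  have e3 : nDeg K₁ z = 3 := (d₁ _ (by grind) (by grind)).trans hz3
  simp only [e1, e2, e3] at k
  simp only [hp2, hr2] at k₁
  exact ⟨H', l, u,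
    by have a := k 0; have b := k₁ 0; simp at a b; omega,
    by have a := k 1; have b := k₁ 1; simp at a b; omega,
    by have a := k 2; have b := k₁ 2; simp at a b; omega,
    by have a := k 3; have b := k₁ 3; simp at a b; omega⟩

end ChainSteps

section ChainSteps

variable {V : Type*} [Fintype V] {G H H' : SimpleGraph V} {S A B : Finset V} {a b v w : V}

set_option maxHeartbeats 1000000 in
lemma reach_A (hG : ∀ v, nDeg G v = 3) (hS : IsClosedIn G S) {m d : ℕ}
    (h : Reach G S m m m (d + 2)) (hd : m ≤ d) :
    Reach G S m (m + 1) m (d + 1) ∨ Reach G S (m + 1) m (m + 1) d := by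
  obtain ⟨H, hle, hu, c0, c1, c2, c3⟩ := h
  have hle3 : ∀ v, nDeg H v ≤ 3 := fun v => hG v ▸ nDeg_mono hle v
  have hpos : ∀ a b, H.Adj a b → 0 < nDeg H a := fun a b hab => nDeg_pos hab
  have hsymm : ∀ a b, H.Adj a b → H.Adj b a := fun a b hab => hab.symm
  have hne : ∀ a b, H.Adj a b → a ≠ b := fun a b hab => hab.ne
  have hSc : ∀ a b, a ∈ S → H.Adj a b → b ∈ S := fun a b ha hab => hS a ha b (hle hab)
  have huniq1 : ∀ v a b, nDeg H v = 1 → H.Adj v a → H.Adj v b → a = b :=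
    fun v a b => eq_of_adj_of_nDeg_one
  by_cases h23 : ∃ a ∈ S, ∃ b, H.Adj a b ∧ nDeg H a = 2 ∧ nDeg H b = 3
  · obtain ⟨a, ha, b, hab, ha2, hb3⟩ := h23
    obtain ⟨H', l, u, -, -, -, -, k⟩ := reach_delete_edge hG hle hu hS ha hab
    simp only [ha2, hb3] at k
    left
    exact ⟨H', l, u,
      by have a := k 0; simp at a; omega,
      by have a := k 1; simp at a; omega,
      by have a := k 2; simp at a; omega,
      by have a := k 3; simp at a; omega⟩
  obtain ⟨a, ha, b, hab, ha3, hb3⟩ :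
      ∃ a ∈ S, ∃ b, H.Adj a b ∧ nDeg H a = 3 ∧ nDeg H b = 3 := by
    by_contra! hc
    have := cnt_le_cnt (i := 3) (j := 1) hle hS (fun a ha ha3 => by
      obtain ⟨b, hb⟩ := exists_adj (H := H) (v := a) (by omega)
      exact ⟨b, hb, by grind⟩) (fun b _ a a' hb _ _ => huniq1 b a a' hb)
    omega
  obtain ⟨y, x, w, hy, hx, hw, hyx, hxw, hy3, hx3, hw3⟩ :=
    exists_path_of_unsaturated hG hle hS hu ha hab ha3 hb3
  have hw1 : nDeg H w = 1 := by grind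
  obtain ⟨H', l, u, k⟩ := reach_delete_path hG hle hu hS hx hyx.symm hxw (by grind)
  simp only [hx3, hy3, hw1] at k
  right
  exact ⟨H', l, u,
    by have a := k 0; simp at a; omega,
    by have a := k 1; simp at a; omega,
    by have a := k 2; simp at a; omega,
    by have a := k 3; simp at a; omega⟩

lemma two_le_cnt {k : ℕ} (ha : a ∈ S) (hb : b ∈ S) (hab : a ≠ b) (hak : nDeg H a = k)
    (hbk : nDeg H b = k) : 2 ≤ cnt S H k := by
  classical
  rw [← Finset.card_pair hab]
  refine Finset.card_le_card fun v hv => ?_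
  simp only [Finset.mem_insert, Finset.mem_singleton] at hv
  rcases hv with rfl | rfl <;> simp [*]

lemma exists_ne_ne_of_cnt {k : ℕ} (a b : V) (h : 2 < cnt S H k) :
    ∃ v ∈ S, v ≠ a ∧ v ≠ b ∧ nDeg H v = k := by
  classical
  obtain ⟨v, hv, hv'⟩ := Finset.exists_mem_notMem_of_card_lt_card
    ((Finset.card_le_two (a := a) (b := b)).trans_lt h)
  simp only [Finset.mem_filter, Finset.mem_insert, Finset.mem_singleton, not_or] at hv hv'
  exact ⟨v, hv.1, hv'.1, hv'.2, hv.2⟩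

set_option maxHeartbeats 1000000 in
/-- The case of `reach_B` in which no vertex of degree one is joined to one of degree three. -/
lemma reach_B_aux (hG : ∀ v, nDeg G v = 3) (hS : IsClosedIn G S) {m d : ℕ}
    (hle : H ≤ G) (hu : Unsaturated G S H) (hc : HasCounts S H m (m + 1) m (d + 2))
    (hd : m + 1 ≤ d)
    (h323 : ∀ p y z, p ∈ S → H.Adj p y → H.Adj p z → y ≠ z → nDeg H p = 2 → nDeg H y = 3 →
      nDeg H z ≠ 3)
    (h13 : ∀ w x, w ∈ S → H.Adj w x → nDeg H w = 1 → nDeg H x ≠ 3) :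
    Reach G S (m + 1) (m + 1) (m + 1) d := by
  obtain ⟨c0, c1, c2, c3⟩ := hc
  have hle3 : ∀ v, nDeg H v ≤ 3 := fun v => hG v ▸ nDeg_mono hle v
  have hpos : ∀ a b, H.Adj a b → 0 < nDeg H a := fun a b hab => nDeg_pos hab
  have hsymm : ∀ a b, H.Adj a b → H.Adj b a := fun a b hab => hab.symm
  have hne : ∀ a b, H.Adj a b → a ≠ b := fun a b hab => hab.ne
  have hSc : ∀ a b, a ∈ S → H.Adj a b → b ∈ S := fun a b ha hab => hS a ha b (hle hab)
  have huniq1 : ∀ v a b, nDeg H v = 1 → H.Adj v a → H.Adj v b → a = b :=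
    fun v a b => eq_of_adj_of_nDeg_one
  have huniq2 : ∀ b a a', nDeg H b = 2 → nDeg H a = 3 → nDeg H a' = 3 → b ∈ S → H.Adj b a →
      H.Adj b a' → a = a' := by
    intro b a a' hb ha ha' hbS hba hba'
    by_contra hne
    exact h323 b a a' hbS hba hba' hne hb ha ha'
  obtain ⟨f, hf, f', hff, hf3, hf'3⟩ :
      ∃ a ∈ S, ∃ b, H.Adj a b ∧ nDeg H a = 3 ∧ nDeg H b = 3 := by
    by_contra! hc
    have := cnt_le_cnt (i := 3) (j := 2) hle hS (fun a ha ha3 => by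
      obtain ⟨b, hb⟩ := exists_adj (H := H) (v := a) (by omega)
      exact ⟨b, hb, by grind⟩) (fun b hbS a a' hb h1 h2 => huniq2 b a a' hb h1 h2 hbS)
    omega
  obtain ⟨q', q, p, hq', hq, hp, hqq, hqp, hq'3, hq3, hp3⟩ :=
    exists_path_of_unsaturated hG hle hS hu hf hff hf3 hf'3
  have hp2 : nDeg H p = 2 := by grind
  by_cases h12 : ∃ a ∈ S, ∃ b, H.Adj a b ∧ nDeg H a = 1 ∧ nDeg H b = 2
  · obtain ⟨a, ha, b, hab, ha1, hb2⟩ := h12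
    obtain ⟨H₁, l₁, u₁, adj₁, da, db, d₁, k₁⟩ := reach_delete_edge hG hle hu hS ha hab
    obtain ⟨H', l, u, -, -, -, -, k⟩ := reach_delete_edge hG l₁ u₁ hS hq
      (show H₁.Adj q q' by grind)
    have e1 : nDeg H₁ q = 3 := (d₁ _ (by grind) (by grind)).trans hq3
    have e2 : nDeg H₁ q' = 3 := (d₁ _ (by grind) (by grind)).trans hq'3
    simp only [e1, e2] at k
    simp only [ha1, hb2] at k₁
    exact ⟨H', l, u,
      by have a := k 0; have b := k₁ 0; simp at a b; omega,
      by have a := k 1; have b := k₁ 1; simp at a b; omega,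
      by have a := k 2; have b := k₁ 2; simp at a b; omega,
      by have a := k 3; have b := k₁ 3; simp at a b; omega⟩
  obtain ⟨r, hrq, hpr⟩ := exists_adj_ne (H := H) (v := p) q (by omega)
  have hr := hSc p r hp hpr
  have hr2 : nDeg H r = 2 := by
    have h1 := hpos r p hpr.symm
    have h2 := hle3 r
    have h3 : nDeg H r ≠ 1 := fun h => h12 ⟨r, hr, p, hpr.symm, h, hp2⟩
    have h4 := h323 p q r hp hqp.symm hpr hrq.symm hp2 hq3
    omega
  have h11 : ∀ a b, a ∈ S → H.Adj a b → nDeg H a = 1 → nDeg H b = 1 := by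
    intro a b ha hab ha1
    have h1 := hpos b a hab.symm
    have h2 := hle3 b
    have h3 : nDeg H b ≠ 2 := fun h => h12 ⟨a, ha, b, hab, ha1, h⟩
    have h4 := h13 a b ha hab ha1
    omega
  by_cases hN : ∃ w ∈ S, ∃ z, G.Adj w z ∧ ¬ H.Adj w z ∧ nDeg H w = 1 ∧ nDeg H z ≠ 0
  · obtain ⟨w, hw, z, hwz, hwz', hw1, hz0⟩ := hN
    obtain ⟨w', hww⟩ := exists_adj (H := H) (v := w) (by omega)
    have hw'1 := h11 w w' hw hww hw1
    have hz := hS w hw z hwz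
    have hwne := hwz.ne
    have hz3 : nDeg H z ≠ 3 := fun h =>
      hwz' (adj_of_nDeg_eq hle (by rw [h, hG]) hwz.symm).symm
    have hzw' : z ≠ w' := fun h => hwz' (h ▸ hww)
    obtain ⟨H₁, l₁, u₁, adj₁, da, db, d₁, k₁⟩ := reach_insert_edge hle hu hS hw hwz hwz'
      (by omega)
    obtain ⟨H₂, l₂, u₂, adj₂, da', db', d₂, k₂⟩ := reach_delete_edge hG l₁ u₁ hS hw
      ((adj₁ w w').2 (Or.inl hww))
    have e1 : nDeg H₁ w = 2 := by omega
    have e2 : nDeg H₁ w' = 1 := (d₁ _ (by grind) (by grind)).trans hw'1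
    have hpw : p ≠ w := by rintro rfl; omega
    have hpw' : p ≠ w' := by rintro rfl; omega
    have hqw : q ≠ w := by rintro rfl; omega
    have hqw' : q ≠ w' := by rintro rfl; omega
    have hqp : q ≠ p := by rintro rfl; omega
    have hqr : q ≠ r := by rintro rfl; omega
    simp only [e1, e2] at k₂
    by_cases hz1 : nDeg H z = 1
    · obtain ⟨H₃, l₃, u₃, adj₃, da'', db'', d₃, k₃⟩ := reach_delete_edge hG l₂ u₂ hS hp
        ((adj₂ _ _).2 ⟨(adj₁ _ _).2 (Or.inl hpr), fun h => hpw h.1, fun h => hpw' h.1⟩)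
      obtain ⟨H', l, u, -, -, -, -, k⟩ := reach_delete_edge hG l₃ u₃ hS hq
        ((adj₃ _ _).2 ⟨(adj₂ _ _).2 ⟨(adj₁ _ _).2 (Or.inl hqq.symm), fun h => hqw h.1,
          fun h => hqw' h.1⟩, fun h => hqp h.1,
        fun h => hqr h.1⟩)
      have e3 : nDeg H₂ p = 2 :=
        (d₂ _ (by grind) (by grind)).trans ((d₁ _ (by grind) (by grind)).trans hp2)
      have e4 : nDeg H₂ r = 2 :=
        (d₂ _ (by grind) (by grind)).trans ((d₁ _ (by grind) (by grind)).trans hr2)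
      have e5 : nDeg H₃ q = 3 :=
        (d₃ _ (by grind) (by grind)).trans
          ((d₂ _ (by grind) (by grind)).trans ((d₁ _ (by grind) (by grind)).trans hq3))
      have e6 : nDeg H₃ q' = 3 :=
        (d₃ _ (by grind) (by grind)).trans
          ((d₂ _ (by grind) (by grind)).trans ((d₁ _ (by grind) (by grind)).trans hq'3))
      simp only [e3, e4] at k₃
      simp only [e5, e6] at k
      simp only [hw1, hz1] at k₁
      exact ⟨H', l, u,
        by have a := k 0; have b := k₁ 0; have c := k₂ 0; have d := k₃ 0; simp at a b c d; omega,
        by have a := k 1; have b := k₁ 1; have c := k₂ 1; have d := k₃ 1; simp at a b c d; omega,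
        by have a := k 2; have b := k₁ 2; have c := k₂ 2; have d := k₃ 2; simp at a b c d; omega,
        by have a := k 3; have b := k₁ 3; have c := k₂ 3; have d := k₃ 3; simp at a b c d; omega⟩
    · have hz2 : nDeg H z = 2 := by have := hle3 z; omega
      by_cases h32 : ∀ a ∈ S, nDeg H a = 3 → ∃ b, H.Adj a b ∧ nDeg H b = 2
      · have := cnt_le_cnt (i := 3) (j := 2) hle hS h32
          (fun b hbS a a' hb h1 h2 => huniq2 b a a' hb h1 h2 hbS)
        omega
      push Not at h32
      obtain ⟨x, hx, hx3, hx1⟩ := h32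
      have hx13 : ∀ y, H.Adj x y → nDeg H y = 3 := by
        intro y hxy
        have h1 := hpos y x hxy.symm
        have h2 := hle3 y
        have h3 : nDeg H y ≠ 1 := fun h => h13 y x (hSc x y hx hxy) hxy.symm h hx3
        have h4 := hx1 y hxy
        omega
      have hxw : x ≠ w := by rintro rfl; omega
      have hxw' : x ≠ w' := by rintro rfl; omega
      obtain ⟨y, hxy⟩ := exists_adj (H := H) (v := x) (by omega)
      obtain ⟨y', hyy, hxy'⟩ := exists_adj_ne (H := H) (v := x) y (by omega)
      have hy3 := hx13 y hxy
      have hy'3 := hx13 y' hxy'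
      obtain ⟨H', l, u, k⟩ := reach_delete_path hG l₂ u₂ hS hx
        ((adj₂ _ _).2 ⟨(adj₁ _ _).2 (Or.inl hxy), fun h => hxw h.1, fun h => hxw' h.1⟩)
        ((adj₂ _ _).2 ⟨(adj₁ _ _).2 (Or.inl hxy'), fun h => hxw h.1, fun h => hxw' h.1⟩) hyy.symm
      have e3 : nDeg H₂ x = 3 :=
        (d₂ _ (by grind) (by grind)).trans ((d₁ _ (by grind) (by grind)).trans hx3)
      have e4 : nDeg H₂ y = 3 :=
        (d₂ _ (by grind) (by grind)).trans ((d₁ _ (by grind) (by grind)).trans hy3)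
      have e5 : nDeg H₂ y' = 3 :=
        (d₂ _ (by grind) (by grind)).trans ((d₁ _ (by grind) (by grind)).trans hy'3)
      simp only [e3, e4, e5] at k
      simp only [hw1, hz2] at k₁
      exact ⟨H', l, u,
        by have a := k 0; have b := k₁ 0; have c := k₂ 0; simp at a b c; omega,
        by have a := k 1; have b := k₁ 1; have c := k₂ 1; simp at a b c; omega,
        by have a := k 2; have b := k₁ 2; have c := k₂ 2; simp at a b c; omega,
        by have a := k 3; have b := k₁ 3; have c := k₂ 3; simp at a b c; omega⟩
  have hN0 : ∀ w z, w ∈ S → G.Adj w z → ¬ H.Adj w z → nDeg H w = 1 → nDeg H z = 0 := by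
    intro w z hw hwz hwz' hw1
    by_contra h
    exact hN ⟨w, hw, z, hwz, hwz', hw1, h⟩
  obtain ⟨w, hw, hw1⟩ := exists_of_cnt_pos (S := S) (H := H) (k := 1) (by omega)
  obtain ⟨w', hww⟩ := exists_adj (H := H) (v := w) (by omega)
  have hw'1 := h11 w w' hw hww hw1
  obtain ⟨z₁, hz₁, hwz₁⟩ := exists_adj_ne (H := G) (v := w) w' (by rw [hG]; omega)
  obtain ⟨z₂, hz₂, hz₁₂, hwz₂⟩ := exists_adj_ne_ne (H := G) (v := w) w' z₁ (by rw [hG]; omega)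
  have := two_le_cnt (H := H) (k := 0) (hS w hw z₁ hwz₁) (hS w hw z₂ hwz₂) hz₁₂.symm
    (hN0 w z₁ hw hwz₁ (fun h => hz₁ (huniq1 w z₁ w' hw1 h hww)) hw1)
    (hN0 w z₂ hw hwz₂ (fun h => hz₂ (huniq1 w z₂ w' hw1 h hww)) hw1)
  obtain ⟨x, hx, hxw, hxw', hx1⟩ := exists_ne_ne_of_cnt (S := S) (H := H) (k := 1) w w' (by omega)
  obtain ⟨z, hxz, hxz'⟩ := exists_adj_not_adj (H := H) (G := G) (v := x) (by rw [hG]; omega)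
  have hz0 := hN0 x z hx hxz hxz' hx1
  obtain ⟨H₁, l₁, u₁, adj₁, da, db, d₁, k₁⟩ := reach_insert_edge hle hu hS hx hxz hxz'
    (by omega)
  obtain ⟨H₂, l₂, u₂, adj₂, da', db', d₂, k₂⟩ := reach_delete_edge hG l₁ u₁ hS hw
    ((adj₁ w w').2 (Or.inl hww))
  have hpw : p ≠ w := by rintro rfl; omega
  have hpw' : p ≠ w' := by rintro rfl; omega
  have hqw : q ≠ w := by rintro rfl; omega
  have hqw' : q ≠ w' := by rintro rfl; omega
  have hqp : q ≠ p := by rintro rfl; omega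
  have hqr : q ≠ r := by rintro rfl; omega
  obtain ⟨H₃, l₃, u₃, adj₃, da'', db'', d₃, k₃⟩ := reach_delete_edge hG l₂ u₂ hS hp
    ((adj₂ _ _).2 ⟨(adj₁ _ _).2 (Or.inl hpr), fun h => hpw h.1, fun h => hpw' h.1⟩)
  obtain ⟨H', l, u, -, -, -, -, k⟩ := reach_delete_edge hG l₃ u₃ hS hq
    ((adj₃ _ _).2 ⟨(adj₂ _ _).2 ⟨(adj₁ _ _).2 (Or.inl hqq.symm), fun h => hqw h.1,
      fun h => hqw' h.1⟩, fun h => hqp h.1,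
        fun h => hqr h.1⟩)
  have e1 : nDeg H₁ w = 1 := (d₁ _ (by grind) (by grind)).trans hw1
  have e2 : nDeg H₁ w' = 1 := (d₁ _ (by grind) (by grind)).trans hw'1
  have e3 : nDeg H₂ p = 2 :=
    (d₂ _ (by grind) (by grind)).trans ((d₁ _ (by grind) (by grind)).trans hp2)
  have e4 : nDeg H₂ r = 2 :=
    (d₂ _ (by grind) (by grind)).trans ((d₁ _ (by grind) (by grind)).trans hr2)
  have e5 : nDeg H₃ q = 3 :=
    (d₃ _ (by grind) (by grind)).trans
      ((d₂ _ (by grind) (by grind)).trans ((d₁ _ (by grind) (by grind)).trans hq3))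
  have e6 : nDeg H₃ q' = 3 :=
    (d₃ _ (by grind) (by grind)).trans
      ((d₂ _ (by grind) (by grind)).trans ((d₁ _ (by grind) (by grind)).trans hq'3))
  simp only [e1, e2] at k₂
  simp only [e3, e4] at k₃
  simp only [e5, e6] at k
  simp only [hx1, hz0] at k₁
  exact ⟨H', l, u,
    by have a := k 0; have b := k₁ 0; have c := k₂ 0; have d := k₃ 0; simp at a b c d; omega,
    by have a := k 1; have b := k₁ 1; have c := k₂ 1; have d := k₃ 1; simp at a b c d; omega,
    by have a := k 2; have b := k₁ 2; have c := k₂ 2; have d := k₃ 2; simp at a b c d; omega,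
    by have a := k 3; have b := k₁ 3; have c := k₂ 3; have d := k₃ 3; simp at a b c d; omega⟩

set_option maxHeartbeats 1000000 in
lemma reach_B (hG : ∀ v, nDeg G v = 3) (hS : IsClosedIn G S) {m d : ℕ}
    (h : Reach G S m (m + 1) m (d + 2)) (hd : m + 1 ≤ d) :
    Reach G S (m + 1) (m + 1) (m + 1) d := by
  obtain ⟨H, hle, hu, c0, c1, c2, c3⟩ := h
  have hle3 : ∀ v, nDeg H v ≤ 3 := fun v => hG v ▸ nDeg_mono hle v
  have hpos : ∀ a b, H.Adj a b → 0 < nDeg H a := fun a b hab => nDeg_pos hab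
  have hsymm : ∀ a b, H.Adj a b → H.Adj b a := fun a b hab => hab.symm
  have hne : ∀ a b, H.Adj a b → a ≠ b := fun a b hab => hab.ne
  have hSc : ∀ a b, a ∈ S → H.Adj a b → b ∈ S := fun a b ha hab => hS a ha b (hle hab)
  have huniq1 : ∀ v a b, nDeg H v = 1 → H.Adj v a → H.Adj v b → a = b :=
    fun v a b => eq_of_adj_of_nDeg_one
  by_cases h331 : ∃ x y w, x ∈ S ∧ H.Adj x y ∧ H.Adj x w ∧ nDeg H x = 3 ∧ nDeg H y = 3 ∧
      nDeg H w = 1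
  · obtain ⟨x, y, w, hx, hxy, hxw, hx3, hy3, hw1⟩ := h331
    obtain ⟨H', l, u, k⟩ := reach_delete_path hG hle hu hS hx hxy hxw (by grind)
    simp only [hx3, hy3, hw1] at k
    exact ⟨H', l, u,
      by have a := k 0; simp at a; omega,
      by have a := k 1; simp at a; omega,
      by have a := k 2; simp at a; omega,
      by have a := k 3; simp at a; omega⟩
  by_cases h323 : ∃ p y z, p ∈ S ∧ H.Adj p y ∧ H.Adj p z ∧ y ≠ z ∧ nDeg H p = 2 ∧
      nDeg H y = 3 ∧ nDeg H z = 3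
  · obtain ⟨p, y, z, hp, hpy, hpz, hyz, hp2, hy3, hz3⟩ := h323
    obtain ⟨H', l, u, k⟩ := reach_delete_path hG hle hu hS hp hpy hpz hyz
    simp only [hp2, hy3, hz3] at k
    exact ⟨H', l, u,
      by have a := k 0; simp at a; omega,
      by have a := k 1; simp at a; omega,
      by have a := k 2; simp at a; omega,
      by have a := k 3; simp at a; omega⟩
  by_cases hdis : ∃ w x p q, w ∈ S ∧ p ∈ S ∧ H.Adj w x ∧ H.Adj p q ∧ q ≠ x ∧ nDeg H w = 1 ∧
      nDeg H x = 3 ∧ nDeg H p = 2 ∧ nDeg H q = 3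
  · obtain ⟨w, x, p, q, hw, hp, hwx, hpq, hqx, hw1, hx3, hp2, hq3⟩ := hdis
    obtain ⟨H₁, l₁, u₁, adj₁, da, db, d₁, k₁⟩ := reach_delete_edge hG hle hu hS hw hwx
    obtain ⟨H', l, u, -, -, -, -, k⟩ := reach_delete_edge hG l₁ u₁ hS hp
      (show H₁.Adj p q by grind)
    have e1 : nDeg H₁ p = 2 := (d₁ _ (by grind) (by grind)).trans hp2
    have e2 : nDeg H₁ q = 3 := (d₁ _ (by grind) (by grind)).trans hq3
    simp only [e1, e2] at k
    simp only [hw1, hx3] at k₁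
    exact ⟨H', l, u,
      by have a := k 0; have b := k₁ 0; simp at a b; omega,
      by have a := k 1; have b := k₁ 1; simp at a b; omega,
      by have a := k 2; have b := k₁ 2; simp at a b; omega,
      by have a := k 3; have b := k₁ 3; simp at a b; omega⟩
  by_cases h13 : ∃ w x, w ∈ S ∧ H.Adj w x ∧ nDeg H w = 1 ∧ nDeg H x = 3
  · obtain ⟨w, x, hw, hwx, hw1, hx3⟩ := h13
    have hxS := hSc w x hw hwx
    exfalso
    have h23 : ∀ p q, p ∈ S → H.Adj p q → nDeg H p = 2 → nDeg H q = 3 → q = x := by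
      intro p q hp hpq hp2 hq3
      by_contra hqx
      exact hdis ⟨w, x, p, q, hw, hp, hwx, hpq, hqx, hw1, hx3, hp2, hq3⟩
    obtain ⟨f, hf, f', hff, hf3, hf'3⟩ :
        ∃ a ∈ S, ∃ b, H.Adj a b ∧ nDeg H a = 3 ∧ nDeg H b = 3 := by
      by_contra! hc
      have := cnt_le_cnt_add_one (i := 3) (j := 1) hle hS x (fun a ha hax ha3 => by
        obtain ⟨b, hb⟩ := exists_adj (H := H) (v := a) (by omega)
        have h1 := hpos b a hb.symm
        have h2 := hle3 b
        have h3 : nDeg H b ≠ 2 := fun h => hax (h23 b a (hSc a b ha hb) hb.symm h ha3)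
        have h4 := hc a ha b hb ha3
        exact ⟨b, hb, by omega⟩) (fun b _ a a' hb _ _ => huniq1 b a a' hb)
      omega
    obtain ⟨y, x', w', hy, hx', hw', hyx, hxw, hy3, hx'3, hw'3⟩ :=
      exists_path_of_unsaturated hG hle hS hu hf hff hf3 hf'3
    have h1 := hpos w' x' hxw.symm
    have h2 := hle3 w'
    have h3 : nDeg H w' ≠ 1 := fun h => h331 ⟨x', y, w', hx', hyx.symm, hxw, hx'3, hy3, h⟩
    have h4 := h23 w' x' hw' hxw.symm (by omega) hx'3
    subst h4
    exact h331 ⟨x', y, w, hx', hyx.symm, hwx.symm, hx'3, hy3, hw1⟩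
  refine reach_B_aux hG hS hle hu ⟨c0, c1, c2, c3⟩ hd ?_ ?_
  · exact fun p y z hp hy hz hyz hp2 hy3 hz3 => h323 ⟨p, y, z, hp, hy, hz, hyz, hp2, hy3, hz3⟩
  · exact fun w x hw hwx hw1 hx3 => h13 ⟨w, x, hw, hwx, hw1, hx3⟩

end ChainSteps

section Balanced

variable {V : Type*} [Fintype V] {G H H' : SimpleGraph V} {S A B : Finset V} {a b v w : V}

/-- `S` carries a spanning subgraph in which all degrees `0`, …, `3` occur equally often, up to
rounding. -/
def Good (G : SimpleGraph V) (S : Finset V) : Prop :=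
  ∃ H ≤ G, ∀ k ≤ 3, cnt S H k = S.card / 4 ∨ cnt S H k = (S.card + 3) / 4

lemma HasCounts.sum_eq (hG : ∀ v, nDeg G v = 3) (hle : H ≤ G) {c₀ c₁ c₂ c₃ : ℕ}
    (h : HasCounts S H c₀ c₁ c₂ c₃) : c₀ + c₁ + c₂ + c₃ = S.card := by
  obtain ⟨h0, h1, h2, h3⟩ := h
  rw [← cnt_sum (S := S) (H := H) fun v _ => hG v ▸ nDeg_mono hle v, h0, h1, h2, h3]

lemma good_of_hasCounts (hG : ∀ v, nDeg G v = 3) (hle : H ≤ G) {c₀ c₁ c₂ c₃ : ℕ}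
    (h : HasCounts S H c₀ c₁ c₂ c₃) (q : ℕ) (h0 : c₀ = q ∨ c₀ = q + 1) (h1 : c₁ = q ∨ c₁ = q + 1)
    (h2 : c₂ = q ∨ c₂ = q + 1) (h3 : c₃ = q ∨ c₃ = q + 1) : Good G S := by
  have hs := h.sum_eq hG hle
  obtain ⟨e0, e1, e2, e3⟩ := h
  refine ⟨H, hle, fun k hk => ?_⟩
  interval_cases k <;> omega

lemma good_of_reach_aux (hG : ∀ v, nDeg G v = 3) (hS : IsClosedIn G S) (d : ℕ) : ∀ m,
    (m ≤ d → d % 2 = m % 2 → Reach G S m m m d → Good G S) ∧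
    (m + 1 ≤ d → d % 2 = (m + 1) % 2 → Reach G S m (m + 1) m d → Good G S) ∧
    (m ≤ d → d % 2 = m % 2 → Reach G S (m + 1) m (m + 1) d → Good G S) := by
  induction d using Nat.strong_induction_on with
  | _ d ih =>
  intro m
  refine ⟨fun h1 h2 hr => ?_, fun h1 h2 hr => ?_, fun h1 h2 hr => ?_⟩
  · obtain rfl | h := h1.eq_or_lt
    · obtain ⟨H, hle, -, hc⟩ := hr
      exact good_of_hasCounts hG hle hc m (by simp) (by simp) (by simp) (by simp)
    · obtain ⟨e, rfl⟩ : ∃ e, d = e + 2 := ⟨d - 2, by omega⟩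
      obtain hr | hr := reach_A hG hS hr (by omega)
      · exact (ih (e + 1) (by omega) m).2.1 (by omega) (by omega) hr
      · exact (ih e (by omega) m).2.2 (by omega) (by omega) hr
  · obtain rfl | h := h1.eq_or_lt
    · obtain ⟨H, hle, -, hc⟩ := hr
      exact good_of_hasCounts hG hle hc m (by simp) (by simp) (by simp) (by simp)
    · obtain ⟨e, rfl⟩ : ∃ e, d = e + 2 := ⟨d - 2, by omega⟩
      exact (ih e (by omega) (m + 1)).1 (by omega) (by omega) (reach_B hG hS hr (by omega))
  · obtain rfl | h := h1.eq_or_lt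
    · obtain ⟨H, hle, -, hc⟩ := hr
      exact good_of_hasCounts hG hle hc m (by simp) (by simp) (by simp) (by simp)
    · obtain ⟨e, rfl⟩ : ∃ e, d = e + 1 := ⟨d - 1, by omega⟩
      exact (ih e (by omega) (m + 1)).1 (by omega) (by omega) (reach_C hG hS hr (by omega))

end Balanced

section LargeComponent

variable {V : Type*} [Fintype V] {G H H' : SimpleGraph V} {C S T A B : Finset V} {a b t v w y : V}

/-- `C` is the vertex set of a connected component. -/
def IsComp (G : SimpleGraph V) (C : Finset V) : Prop :=
  C.Nonempty ∧ IsClosedIn G C ∧ ∀ W ⊆ C, W.Nonempty → IsClosedIn G W → W = C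

open Classical in
/-- The neighbors of `v` in `T`. -/
noncomputable def nbrsIn (G : SimpleGraph V) (T : Finset V) (v : V) : Finset V :=
  T.filter fun w => G.Adj v w

lemma mem_nbrsIn : w ∈ nbrsIn G T v ↔ w ∈ T ∧ G.Adj v w := by
  simp [nbrsIn]

lemma card_nbrsIn_le (v : V) : (nbrsIn G T v).card ≤ nDeg G v :=
  card_le_nDeg _ fun _ hw => (mem_nbrsIn.mp hw).2

/-- Twice the number of edges inside `T`. -/
noncomputable def twiceEdges (G : SimpleGraph V) (T : Finset V) : ℕ :=
  ∑ v ∈ T, (nbrsIn G T v).card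

lemma twiceEdges_insert [DecidableEq V] (hy : y ∉ T) :
    twiceEdges G (insert y T) = twiceEdges G T + 2 * (nbrsIn G T y).card := by
  classical
  unfold twiceEdges nbrsIn
  simp only [Finset.card_filter]
  rw [Finset.sum_insert hy]
  simp only [Finset.sum_insert hy, Finset.sum_add_distrib]
  simp only [SimpleGraph.irrefl, if_false, fun v => G.adj_comm v y]
  ring

lemma twiceEdges_erase [DecidableEq V] (ht : t ∈ T) :
    twiceEdges G (T.erase t) + 2 * (nbrsIn G T t).card = twiceEdges G T := by
  have h := twiceEdges_insert (G := G) (Finset.notMem_erase t T)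
  rw [Finset.insert_erase ht] at h
  rw [h]
  congr 3
  ext w
  simp only [mem_nbrsIn, Finset.mem_erase]
  constructor
  · exact fun hw => ⟨⟨hw.2.ne', hw.1⟩, hw.2⟩
  · exact fun hw => ⟨hw.1.2, hw.2⟩

lemma twiceEdges_even : Even (twiceEdges G T) := by
  classical
  induction T using Finset.induction_on with
  | empty => simp [twiceEdges]
  | insert y T hy ih =>
    rw [twiceEdges_insert hy]
    exact ih.add (even_two_mul _)

lemma card_nbrsIn_eq (hS : IsClosedIn G S) (hv : v ∈ S) : (nbrsIn G S v).card = nDeg G v := by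
  rw [nDeg, ← Set.ncard_coe_finset]
  congr 1
  ext w
  simp only [Finset.mem_coe, mem_nbrsIn, SimpleGraph.mem_neighborSet]
  exact ⟨fun h => h.2, fun h => ⟨hS v hv w h, h⟩⟩

/-- A component contains an induced cycle that is small in the sense that no smaller set spans as
many edges as vertices. -/
lemma exists_two_regular (hG : ∀ v, nDeg G v = 3) (hC : IsComp G C) (hcard : 4 ≤ C.card) :
    ∃ T ⊆ C, 3 ≤ T.card ∧ (∀ t ∈ T, (nbrsIn G T t).card = 2) ∧
      twiceEdges G T = 2 * T.card ∧
      ∀ T' ⊆ C, T'.Nonempty → T'.card < T.card → twiceEdges G T' < 2 * T'.card := by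
  classical
  have hfC : twiceEdges G C = C.card * 3 := by
    unfold twiceEdges
    rw [Finset.sum_congr rfl fun v hv => (card_nbrsIn_eq hC.2.1 hv).trans (hG v)]
    simp
  have hex : ∃ n, ∃ T ⊆ C, T.Nonempty ∧ 2 * T.card ≤ twiceEdges G T ∧ T.card = n :=
    ⟨_, C, subset_rfl, hC.1, by omega, rfl⟩
  obtain ⟨T, hTC, hTne, hT2, hTn⟩ := Nat.find_spec hex
  have hmin : ∀ T' ⊆ C, T'.Nonempty → T'.card < T.card → twiceEdges G T' < 2 * T'.card := by
    intro T' h1 h2 h3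
    by_contra! h4
    exact Nat.find_min hex (hTn ▸ h3) ⟨T', h1, h2, h4, rfl⟩
  have hlow : ∀ t ∈ T, 2 * T.card ≤ twiceEdges G T → twiceEdges G T + 3 ≤
      2 * T.card + 2 * (nbrsIn G T t).card := by
    intro t ht h2
    have h1 := twiceEdges_erase (G := G) ht
    have h3 := Finset.card_erase_of_mem ht
    have h4 := Finset.card_pos.mpr hTne
    by_cases hne : (T.erase t).Nonempty
    · have := hmin (T.erase t) ((Finset.erase_subset _ _).trans hTC) hne (by omega)
      omega
    · rw [Finset.not_nonempty_iff_eq_empty] at hne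
      rw [hne] at h1 h3
      have h5 : (nbrsIn G T t).card = 0 := by
        rw [Finset.card_eq_zero, Finset.eq_empty_iff_forall_notMem]
        intro w hw
        obtain ⟨h6, h7⟩ := mem_nbrsIn.mp hw
        have : w ∈ T.erase t := Finset.mem_erase.mpr ⟨h7.ne', h6⟩
        rw [hne] at this
        simp at this
      have h6 : twiceEdges G (∅ : Finset V) = 0 := by simp [twiceEdges]
      rw [Finset.card_empty] at h3
      omega
  have heven := twiceEdges_even (G := G) (T := T)
  have hle3 : ∀ t, (nbrsIn G T t).card ≤ 3 := fun t => hG t ▸ card_nbrsIn_le t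
  have hfT : twiceEdges G T = 2 * T.card := by
    by_contra hne
    obtain ⟨e, he⟩ := heven
    have h3 : ∀ t ∈ T, (nbrsIn G T t).card = 3 := by
      intro t ht
      have := hlow t ht hT2
      have := hle3 t
      omega
    have hcl : IsClosedIn G T := by
      intro t ht w hw
      by_contra hwT
      have := card_le_nDeg (H := G) (v := t) (insert w (nbrsIn G T t)) (by
        intro x hx
        rcases Finset.mem_insert.mp hx with rfl | hx
        · exact hw
        · exact (mem_nbrsIn.mp hx).2)
      rw [Finset.card_insert_of_notMem (fun h => hwT (mem_nbrsIn.mp h).1), h3 t ht, hG] at this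
      omega
    have := hC.2.2 T hTC hTne hcl
    subst this
    obtain ⟨t, ht⟩ := hTne
    have := hlow t ht hT2
    have := hle3 t
    omega
  have h2 : ∀ t ∈ T, (nbrsIn G T t).card = 2 := by
    have hge : ∀ t ∈ T, 2 ≤ (nbrsIn G T t).card := fun t ht => by
      have := hlow t ht hT2
      omega
    have hsum : ∑ t ∈ T, 2 = ∑ t ∈ T, (nbrsIn G T t).card := by
      have : ∑ t ∈ T, (nbrsIn G T t).card = 2 * T.card := hfT
      rw [this]
      simp [mul_comm]
    exact fun t ht => ((Finset.sum_eq_sum_iff_of_le hge).mp hsum t ht).symm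
  refine ⟨T, hTC, ?_, h2, hfT, hmin⟩
  obtain ⟨t, ht⟩ := hTne
  have h3 : (insert t (nbrsIn G T t)).card = 3 := by
    rw [Finset.card_insert_of_notMem (fun h => (mem_nbrsIn.mp h).2.ne rfl), h2 t ht]
  rw [← h3]
  refine Finset.card_le_card fun x hx => ?_
  rcases Finset.mem_insert.mp hx with rfl | hx
  · exact ht
  · exact (mem_nbrsIn.mp hx).1

lemma exists_outer (hG : ∀ v, nDeg G v = 3) (h2 : ∀ t ∈ T, (nbrsIn G T t).card = 2) :
    ∃ o : V → V, ∀ t ∈ T, ∀ w, G.Adj t w ∧ w ∉ T ↔ w = o t := by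
  classical
  have : ∀ t ∈ T, ∃ o, ∀ w, G.Adj t w ∧ w ∉ T ↔ w = o := by
    intro t ht
    obtain ⟨o, ho, hto⟩ := exists_adj_notMem (H := G) (v := t) (nbrsIn G T t)
      (by rw [h2 t ht, hG]; omega)
    have hoT : o ∉ T := fun h => ho (mem_nbrsIn.mpr ⟨h, hto⟩)
    refine ⟨o, fun w => ⟨fun hw => ?_, fun hw => hw ▸ ⟨hto, hoT⟩⟩⟩
    by_contra hwo
    have := card_le_nDeg (H := G) (v := t) (insert w (insert o (nbrsIn G T t))) (by
      intro x hx
      simp only [Finset.mem_insert] at hx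
      rcases hx with rfl | rfl | hx
      · exact hw.1
      · exact hto
      · exact (mem_nbrsIn.mp hx).2)
    rw [Finset.card_insert_of_notMem, Finset.card_insert_of_notMem ho, h2 t ht, hG] at this
    · omega
    · simp only [Finset.mem_insert, not_or]
      exact ⟨hwo, fun h => hw.2 (mem_nbrsIn.mp h).1⟩
  choose! o ho using this
  exact ⟨o, ho⟩

/-- Distinct vertices of a long shortest cycle have distinct neighbors outside it. -/
lemma outer_injOn (hC : IsClosedIn G C) (hTC : T ⊆ C)
    (h2 : ∀ t ∈ T, (nbrsIn G T t).card = 2) (hT : twiceEdges G T = 2 * T.card)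
    (hmin : ∀ T' ⊆ C, T'.Nonempty → T'.card < T.card → twiceEdges G T' < 2 * T'.card)
    (h5 : 5 ≤ T.card) {o : V → V} (ho : ∀ t ∈ T, ∀ w, G.Adj t w ∧ w ∉ T ↔ w = o t) :
    Set.InjOn o T := by
  classical
  intro s hs s' hs' hss
  by_contra hne
  have hs : s ∈ T := hs
  have hs' : s' ∈ T := hs'
  have hy := (ho s hs (o s)).mpr rfl
  have hy' := (ho s' hs' (o s)).mpr hss
  set y := o s
  obtain ⟨t, ht, htn⟩ := Finset.exists_mem_notMem_of_card_lt_card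
    (s := insert s (insert s' (nbrsIn G T s))) (t := T) (by
      have h1 := Finset.card_insert_le s (insert s' (nbrsIn G T s))
      have h2' := Finset.card_insert_le s' (nbrsIn G T s)
      have := h2 s hs
      omega)
  simp only [Finset.mem_insert, not_or, mem_nbrsIn, not_and] at htn
  obtain ⟨hts, hts', hst⟩ := htn
  obtain ⟨t', ht', ht'n⟩ := Finset.exists_mem_notMem_of_card_lt_card
    (s := {s'}) (t := nbrsIn G T t) (by rw [h2 t ht]; simp)
  obtain ⟨ht'T, htt'⟩ := mem_nbrsIn.mp ht'
  have ht's' : t' ≠ s' := by simpa using ht'n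
  have ht's : t' ≠ s := by
    rintro rfl
    exact hst ht htt'.symm
  have ht'e : t' ∈ T.erase t := Finset.mem_erase.mpr ⟨htt'.ne', ht'T⟩
  have e1 := twiceEdges_erase (G := G) ht
  have e2 := twiceEdges_erase (G := G) ht'e
  have e3 : (nbrsIn G (T.erase t) t').card + 1 = 2 := by
    rw [← h2 t' ht'T]
    have : nbrsIn G (T.erase t) t' = (nbrsIn G T t').erase t := by
      ext x
      simp only [mem_nbrsIn, Finset.mem_erase]
      tauto
    rw [this]
    exact Finset.card_erase_add_one (mem_nbrsIn.mpr ⟨ht, htt'.symm⟩)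
  have hyn : y ∉ (T.erase t).erase t' := fun h =>
    hy.2 (Finset.mem_of_mem_erase (Finset.mem_of_mem_erase h))
  have e4 := twiceEdges_insert (G := G) hyn
  have e5 : 2 ≤ (nbrsIn G ((T.erase t).erase t') y).card := by
    rw [← Finset.card_pair hne]
    refine Finset.card_le_card fun x hx => ?_
    simp only [Finset.mem_insert, Finset.mem_singleton] at hx
    simp only [mem_nbrsIn, Finset.mem_erase]
    rcases hx with rfl | rfl
    · exact ⟨⟨ht's.symm, Ne.symm hts, hs⟩, hy.1.symm⟩
    · exact ⟨⟨ht's'.symm, Ne.symm hts', hs'⟩, hy'.1.symm⟩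
  have c1 := Finset.card_erase_of_mem ht
  have c2 := Finset.card_erase_of_mem ht'e
  have c3 := Finset.card_insert_of_notMem hyn
  have := hmin (insert y ((T.erase t).erase t')) (by
    intro x hx
    simp only [Finset.mem_insert, Finset.mem_erase] at hx
    rcases hx with rfl | hx
    · exact hC s (hTC hs) _ hy.1
    · exact hTC hx.2.2) ⟨y, Finset.mem_insert_self _ _⟩ (by omega)
  have := h2 t ht
  omega

/-- Delete all edges inside `T`, and all edges at `P ⊆ T`. -/
def pendantGraph (G : SimpleGraph V) (T P : Finset V) : SimpleGraph V where
  Adj x y := G.Adj x y ∧ ¬ (x ∈ T ∧ y ∈ T) ∧ x ∉ P ∧ y ∉ P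
  symm := ⟨fun _ _ h => ⟨h.1.symm, fun h' => h.2.1 ⟨h'.2, h'.1⟩, h.2.2.2, h.2.2.1⟩⟩
  loopless := ⟨fun _ h => h.1.ne rfl⟩

lemma reach_pendant (hG : ∀ v, nDeg G v = 3) (hC : IsComp G C) (hTC : T ⊆ C) (hT : T.Nonempty)
    {o : V → V} (ho : ∀ t ∈ T, ∀ w, G.Adj t w ∧ w ∉ T ↔ w = o t) {P : Finset V} (hP : P ⊆ T)
    (hinj : Set.InjOn o P) :
    Reach G C P.card (T.card - P.card) P.card (C.card - T.card - P.card) := by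
  classical
  set H := pendantGraph G T P with hH
  have hle : H ≤ G := fun x y h => h.1
  have d0 : ∀ x ∈ P, nDeg H x = 0 := by
    intro x hx
    have : H.neighborSet x = ∅ := by
      ext y
      simp only [SimpleGraph.mem_neighborSet, Set.mem_empty_iff_false, iff_false]
      exact fun h => h.2.2.1 hx
    rw [nDeg, this, Set.ncard_empty]
  have d1 : ∀ x ∈ T, x ∉ P → nDeg H x = 1 := by
    intro x hx hxP
    have : H.neighborSet x = {o x} := by
      ext y
      rw [SimpleGraph.mem_neighborSet, Set.mem_singleton_iff, ← ho x hx y]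
      exact ⟨fun h => ⟨h.1, fun hy => h.2.1 ⟨hx, hy⟩⟩,
        fun h => ⟨h.1, fun hy => h.2 hy.2, hxP, fun hy => h.2 (hP hy)⟩⟩
    rw [nDeg, this, Set.ncard_singleton]
  have d2 : ∀ t ∈ P, nDeg H (o t) = 2 := by
    intro t ht
    have hto := (ho t (hP ht) (o t)).mpr rfl
    have : H.neighborSet (o t) = G.neighborSet (o t) \ {t} := by
      ext y
      simp only [SimpleGraph.mem_neighborSet, Set.mem_sdiff, Set.mem_singleton_iff]
      refine ⟨fun h => ⟨h.1, fun hy => h.2.2.2 (hy ▸ ht)⟩, fun h => ⟨h.1, fun hy => hto.2 hy.1,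
        fun hy => hto.2 (hP hy), fun hy => h.2 ?_⟩⟩
      exact hinj hy ht ((ho y (hP hy) (o t)).mp ⟨h.1.symm, hto.2⟩).symm
    rw [nDeg, this]
    have h1 := Set.ncard_sdiff_singleton_add_one (s := G.neighborSet (o t)) (a := t) hto.1.symm
      (Set.toFinite _)
    have h2 := hG (o t)
    unfold nDeg at h2
    omega
  have d3 : ∀ x ∉ T, (∀ t ∈ P, x ≠ o t) → nDeg H x = 3 := by
    intro x hx hxo
    have : H.neighborSet x = G.neighborSet x := by
      ext y
      simp only [SimpleGraph.mem_neighborSet]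
      exact ⟨fun h => h.1, fun h => ⟨h, fun hy => hx hy.1, fun hy => hx (hP hy),
        fun hy => hxo y hy ((ho y (hP hy) x).mp ⟨h.symm, hx⟩)⟩⟩
    rw [nDeg, this]
    exact hG x
  have cover : ∀ x, x ∈ P ∨ (x ∈ T ∧ x ∉ P) ∨ (∃ t ∈ P, o t = x) ∨
      (x ∉ T ∧ ∀ t ∈ P, x ≠ o t) := by
    intro x
    by_cases h1 : x ∈ P
    · exact Or.inl h1
    by_cases h2 : x ∈ T
    · exact Or.inr (Or.inl ⟨h2, h1⟩)
    by_cases h3 : ∃ t ∈ P, o t = x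
    · exact Or.inr (Or.inr (Or.inl h3))
    · push Not at h3
      exact Or.inr (Or.inr (Or.inr ⟨h2, fun t ht => (h3 t ht).symm⟩))
  have c0 : cnt C H 0 = P.card := by
    unfold cnt
    congr 1
    ext x
    simp only [Finset.mem_filter]
    refine ⟨fun h => ?_, fun h => ⟨hTC (hP h), d0 x h⟩⟩
    rcases cover x with hx | ⟨h1, h2⟩ | ⟨t, ht, rfl⟩ | ⟨h1, h2⟩
    · exact hx
    · have := d1 x h1 h2; omega
    · have := d2 t ht; omega
    · have := d3 x h1 h2; omega
  have c1 : cnt C H 1 = T.card - P.card := by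
    rw [← Finset.card_sdiff_of_subset hP]
    unfold cnt
    congr 1
    ext x
    simp only [Finset.mem_filter, Finset.mem_sdiff]
    refine ⟨fun h => ?_, fun h => ⟨hTC h.1, d1 x h.1 h.2⟩⟩
    rcases cover x with hx | hx | ⟨t, ht, rfl⟩ | ⟨h1, h2⟩
    · have := d0 x hx; omega
    · exact hx
    · have := d2 t ht; omega
    · have := d3 x h1 h2; omega
  have c2 : cnt C H 2 = P.card := by
    rw [← Finset.card_image_of_injOn hinj]
    unfold cnt
    congr 1
    ext x
    simp only [Finset.mem_filter, Finset.mem_image]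
    refine ⟨fun h => ?_, fun ⟨t, ht, hx⟩ => ⟨?_, hx ▸ d2 t ht⟩⟩
    · rcases cover x with hx | ⟨h1, h2⟩ | hx | ⟨h1, h2⟩
      · have := d0 x hx; omega
      · have := d1 x h1 h2; omega
      · exact hx
      · have := d3 x h1 h2; omega
    · exact hx ▸ hC.2.1 t (hTC (hP ht)) _ ((ho t (hP ht) _).mpr rfl).1
  have hsum := cnt_sum (S := C) (H := H) fun v _ => hG v ▸ nDeg_mono hle v
  have := Finset.card_le_card hP
  refine ⟨H, hle, ?_, c0, c1, c2, by omega⟩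
  intro W hW hne hcl
  rw [hC.2.2 W hW hne hcl]
  obtain ⟨t, ht⟩ := hT
  refine ⟨t, hTC ht, ?_⟩
  by_cases htP : t ∈ P
  · rw [d0 t htP]; omega
  · rw [d1 t ht htP]; omega

end LargeComponent

section GoodComponent

variable {V : Type*} [Fintype V] {G H H' : SimpleGraph V} {C S T A B : Finset V} {a b t v w y : V}

lemma even_sum_nDeg (hS : IsClosedIn G S) (hle : H ≤ G) : Even (∑ v ∈ S, nDeg H v) := by
  have hS' : IsClosedIn H S := fun v hv w hw => hS v hv w (hle hw)
  rw [← Finset.sum_congr rfl fun v hv => card_nbrsIn_eq hS' hv]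
  exact twiceEdges_even

lemma IsClosedIn.even_card (hG : ∀ v, nDeg G v = 3) (hS : IsClosedIn G S) : Even S.card := by
  have h := even_sum_nDeg hS le_rfl
  rw [Finset.sum_congr rfl fun v _ => hG v, Finset.sum_const, smul_eq_mul] at h
  exact (Nat.even_mul.mp h).resolve_right (by decide)

lemma IsClosedIn.four_le_card (hG : ∀ v, nDeg G v = 3) (hS : IsClosedIn G S) (hne : S.Nonempty) :
    4 ≤ S.card := by
  classical
  obtain ⟨v, hv⟩ := hne
  have h1 := card_nbrsIn_eq hS hv
  rw [hG v] at h1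
  have h2 : (insert v (nbrsIn G S v)).card = 4 := by
    rw [Finset.card_insert_of_notMem (fun h => (mem_nbrsIn.mp h).2.ne rfl), h1]
  rw [← h2]
  refine Finset.card_le_card fun x hx => ?_
  rcases Finset.mem_insert.mp hx with rfl | hx
  · exact hv
  · exact (mem_nbrsIn.mp hx).1

lemma IsComp.good (hG : ∀ v, nDeg G v = 3) (hC : IsComp G C) (h8 : 8 ≤ C.card) : Good G C := by
  classical
  obtain ⟨T, hTC, h3, h2, hT2, hmin⟩ := exists_two_regular hG hC (by omega)
  obtain ⟨o, ho⟩ := exists_outer hG h2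
  have hTne : T.Nonempty := Finset.card_pos.mp (by omega)
  have hn : 2 * T.card ≤ C.card ∧ ∃ P ⊆ T, P.card = T.card / 2 ∧ Set.InjOn o P := by
    obtain h | h | h : T.card = 3 ∨ T.card = 4 ∨ 5 ≤ T.card := by omega
    · obtain ⟨t, ht⟩ := hTne
      exact ⟨by omega, {t}, by simpa using ht, by simp [h], by simp⟩
    · obtain ⟨t, ht⟩ := hTne
      obtain ⟨s, hs, hst⟩ : ∃ s ∈ T, o s ≠ o t := by
        by_contra! hc
        have := card_le_nDeg (H := G) (v := o t) T fun s hs =>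
          hc s hs ▸ ((ho s hs (o s)).mpr rfl).1.symm
        rw [h, hG] at this
        omega
      have hne : s ≠ t := fun h => hst (h ▸ rfl)
      refine ⟨by omega, {s, t}, ?_, by rw [Finset.card_pair hne, h], ?_⟩
      · intro x hx
        simp only [Finset.mem_insert, Finset.mem_singleton] at hx
        rcases hx with rfl | rfl <;> assumption
      · intro x hx y hy hxy
        simp only [Finset.coe_insert, Finset.coe_singleton, Set.mem_insert_iff,
          Set.mem_singleton_iff] at hx hy
        rcases hx with rfl | rfl <;> rcases hy with rfl | rfl
        · rfl
        · exact absurd hxy hst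
        · exact absurd hxy.symm hst
        · rfl
    · have hinj := outer_injOn hC.2.1 hTC h2 hT2 hmin h ho
      obtain ⟨P, hP, hPc⟩ := Finset.exists_subset_card_eq (s := T) (n := T.card / 2) (by omega)
      refine ⟨?_, P, hP, hPc, hinj.mono (by exact_mod_cast hP)⟩
      have h4 : T.card ≤ (C \ T).card := by
        refine Finset.card_le_card_of_injOn o (fun t ht => ?_) hinj
        have := (ho t ht (o t)).mpr rfl
        exact_mod_cast Finset.mem_sdiff.mpr ⟨hC.2.1 t (hTC ht) _ this.1, this.2⟩
      rw [Finset.card_sdiff_of_subset hTC] at h4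
      have := Finset.card_le_card hTC
      omega
  obtain ⟨hn, P, hP, hPc, hinj⟩ := hn
  have hr := reach_pendant hG hC hTC hTne ho hP hinj
  obtain ⟨m, hm⟩ := hC.2.1.even_card hG
  have haux := good_of_reach_aux hG hC.2.1 (C.card - T.card - P.card) P.card
  obtain h | h : T.card - P.card = P.card ∨ T.card - P.card = P.card + 1 := by omega
  · rw [h] at hr
    exact haux.1 (by omega) (by omega) hr
  · rw [h] at hr
    exact haux.2.1 (by omega) (by omega) hr

end GoodComponent

section Realizes

variable {V : Type*} [Fintype V] {G H H' : SimpleGraph V} {C S T A B : Finset V} {a b t v w y : V}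
  {c₀ c₁ c₂ c₃ d₀ d₁ d₂ d₃ : ℕ}

/-- Some subgraph of `G` has `cₖ` vertices of degree `k` in `S`. -/
def Realizes (G : SimpleGraph V) (S : Finset V) (c₀ c₁ c₂ c₃ : ℕ) : Prop :=
  ∃ H ≤ G, HasCounts S H c₀ c₁ c₂ c₃

lemma Realizes.sum_eq (hG : ∀ v, nDeg G v = 3) (h : Realizes G S c₀ c₁ c₂ c₃) :
    c₀ + c₁ + c₂ + c₃ = S.card := by
  obtain ⟨H, hle, h⟩ := h
  exact h.sum_eq hG hle

lemma Realizes.good (hG : ∀ v, nDeg G v = 3) (h : Realizes G S c₀ c₁ c₂ c₃) (q : ℕ)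
    (h0 : c₀ = q ∨ c₀ = q + 1) (h1 : c₁ = q ∨ c₁ = q + 1) (h2 : c₂ = q ∨ c₂ = q + 1)
    (h3 : c₃ = q ∨ c₃ = q + 1) : Good G S := by
  obtain ⟨H, hle, h⟩ := h
  exact good_of_hasCounts hG hle h q h0 h1 h2 h3

lemma Good.realizes (h : Good G S) : ∃ c₀ c₁ c₂ c₃, Realizes G S c₀ c₁ c₂ c₃ ∧
    (c₀ = S.card / 4 ∨ c₀ = (S.card + 3) / 4) ∧ (c₁ = S.card / 4 ∨ c₁ = (S.card + 3) / 4) ∧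
    (c₂ = S.card / 4 ∨ c₂ = (S.card + 3) / 4) ∧ (c₃ = S.card / 4 ∨ c₃ = (S.card + 3) / 4) := by
  obtain ⟨H, hle, h⟩ := h
  exact ⟨_, _, _, _, ⟨H, hle, rfl, rfl, rfl, rfl⟩, h 0 (by simp), h 1 (by simp), h 2 (by simp),
    h 3 (by simp)⟩

lemma Realizes.compl (hG : ∀ v, nDeg G v = 3) (h : Realizes G S c₀ c₁ c₂ c₃) :
    Realizes G S c₃ c₂ c₁ c₀ := by
  obtain ⟨H, hle, h0, h1, h2, h3⟩ := h
  have key : ∀ i j : ℕ, i + j = 3 → cnt S (G \ H) i = cnt S H j := by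
    intro i j hij
    unfold cnt
    congr 1
    refine Finset.filter_congr fun v _ => ?_
    have h := nDeg_mono hle v
    rw [nDeg_sdiff hle, hG]
    rw [hG] at h
    omega
  exact ⟨G \ H, sdiff_le, (key 0 3 rfl).trans h3, (key 1 2 rfl).trans h2, (key 2 1 rfl).trans h1,
    (key 3 0 rfl).trans h0⟩

lemma Realizes.even (hG : ∀ v, nDeg G v = 3) (hS : IsClosedIn G S) (h : Realizes G S c₀ c₁ c₂ c₃) :
    Even (c₁ + c₃) := by
  obtain ⟨H, hle, h0, h1, h2, h3⟩ := h
  have h := even_sum_nDeg hS hle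
  have key : ∑ v ∈ S, nDeg H v = cnt S H 1 + 2 * cnt S H 2 + 3 * cnt S H 3 := by
    unfold cnt
    simp only [Finset.card_filter, Finset.mul_sum, ← Finset.sum_add_distrib]
    refine Finset.sum_congr rfl fun v _ => ?_
    have := nDeg_mono hle v
    rw [hG] at this
    interval_cases nDeg H v <;> simp
  rw [key, h1, h2, h3] at h
  obtain ⟨e, he⟩ := h
  exact ⟨e - c₂ - c₃, by omega⟩

/-- Glue `H` on `A` and `H'` outside `A`. -/
lemma exists_glue (hA : IsClosedIn G A) (hle : H ≤ G) (hle' : H' ≤ G) : ∃ K ≤ G,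
    (∀ v ∈ A, nDeg K v = nDeg H v) ∧ ∀ v ∉ A, nDeg K v = nDeg H' v := by
  have hadj : ∀ x y, G.Adj x y → (x ∈ A ↔ y ∈ A) := fun x y h =>
    ⟨fun hx => hA x hx y h, fun hy => hA y hy x h.symm⟩
  let K : SimpleGraph V :=
    { Adj := fun x y => (x ∈ A ∧ H.Adj x y) ∨ (x ∉ A ∧ H'.Adj x y)
      symm := ⟨fun x y h => by
        rcases h with ⟨hx, h⟩ | ⟨hx, h⟩
        · exact Or.inl ⟨(hadj x y (hle h)).mp hx, h.symm⟩
        · exact Or.inr ⟨fun hy => hx ((hadj x y (hle' h)).mpr hy), h.symm⟩⟩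
      loopless := ⟨fun x h => by simp at h⟩ }
  refine ⟨K, fun x y h => ?_, fun v hv => ?_, fun v hv => ?_⟩
  · rcases h with ⟨-, h⟩ | ⟨-, h⟩
    exacts [hle h, hle' h]
  · unfold nDeg
    congr 1
    ext w
    simp [K, hv]
  · unfold nDeg
    congr 1
    ext w
    simp [K, hv]

lemma HasCounts.union [DecidableEq V] {K : SimpleGraph V} (hd : Disjoint A B)
    (h : HasCounts A H c₀ c₁ c₂ c₃) (h' : HasCounts B H' d₀ d₁ d₂ d₃)
    (hKA : ∀ v ∈ A, nDeg K v = nDeg H v) (hKB : ∀ v ∉ A, nDeg K v = nDeg H' v) :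
    HasCounts (A ∪ B) K (c₀ + d₀) (c₁ + d₁) (c₂ + d₂) (c₃ + d₃) := by
  obtain ⟨h0, h1, h2, h3⟩ := h
  obtain ⟨h0', h1', h2', h3'⟩ := h'
  have key : ∀ k, cnt (A ∪ B) K k = cnt A H k + cnt B H' k := fun k => by
    rw [cnt_union hd, cnt_congr hKA, cnt_congr fun v hv => hKB v fun hA =>
      Finset.disjoint_left.mp hd hA hv]
  refine ⟨?_, ?_, ?_, ?_⟩ <;> rw [key] <;> omega

lemma Realizes.union [DecidableEq V] (hA : IsClosedIn G A) (hd : Disjoint A B)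
    (h : Realizes G A c₀ c₁ c₂ c₃) (h' : Realizes G B d₀ d₁ d₂ d₃) :
    Realizes G (A ∪ B) (c₀ + d₀) (c₁ + d₁) (c₂ + d₂) (c₃ + d₃) := by
  obtain ⟨H, hle, hc⟩ := h
  obtain ⟨H', hle', hc'⟩ := h'
  obtain ⟨K, hK, hKA, hKB⟩ := exists_glue hA hle hle'
  exact ⟨K, hK, hc.union hd hc' hKA hKB⟩

lemma IsClosedIn.inter [DecidableEq V] (hA : IsClosedIn G A) (hB : IsClosedIn G B) :
    IsClosedIn G (A ∩ B) := fun v hv w hw =>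
  Finset.mem_inter.mpr ⟨hA v (Finset.mem_inter.mp hv).1 w hw, hB v (Finset.mem_inter.mp hv).2 w hw⟩

lemma IsClosedIn.union [DecidableEq V] (hA : IsClosedIn G A) (hB : IsClosedIn G B) :
    IsClosedIn G (A ∪ B) := fun v hv w hw =>
  Finset.mem_union.mpr ((Finset.mem_union.mp hv).imp (fun h => hA v h w hw) fun h => hB v h w hw)

lemma IsClosedIn.sdiff [DecidableEq V] (hA : IsClosedIn G A) (hB : IsClosedIn G B) :
    IsClosedIn G (A \ B) := fun v hv w hw =>
  Finset.mem_sdiff.mpr ⟨hA v (Finset.mem_sdiff.mp hv).1 w hw,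
    fun h => (Finset.mem_sdiff.mp hv).2 (hB w h v hw.symm)⟩

lemma Reach.union [DecidableEq V] (hA : IsClosedIn G A) (hB : IsClosedIn G B) (hd : Disjoint A B)
    (h : Reach G A c₀ c₁ c₂ c₃) (h' : Reach G B d₀ d₁ d₂ d₃) :
    Reach G (A ∪ B) (c₀ + d₀) (c₁ + d₁) (c₂ + d₂) (c₃ + d₃) := by
  obtain ⟨H, hle, hu, hc⟩ := h
  obtain ⟨H', hle', hu', hc'⟩ := h'
  obtain ⟨K, hK, hKA, hKB⟩ := exists_glue hA hle hle'
  refine ⟨K, hK, fun W hW ⟨x, hx⟩ hcl => ?_, hc.union hd hc' hKA hKB⟩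
  rcases Finset.mem_union.mp (hW hx) with hxA | hxB
  · obtain ⟨v, hv, h3⟩ := hu (W ∩ A) Finset.inter_subset_right
      ⟨x, Finset.mem_inter.mpr ⟨hx, hxA⟩⟩ (hcl.inter hA)
    rw [Finset.mem_inter] at hv
    exact ⟨v, hv.1, by rwa [hKA v hv.2]⟩
  · obtain ⟨v, hv, h3⟩ := hu' (W ∩ B) Finset.inter_subset_right
      ⟨x, Finset.mem_inter.mpr ⟨hx, hxB⟩⟩ (hcl.inter hB)
    rw [Finset.mem_inter] at hv
    exact ⟨v, hv.1, by rwa [hKB v fun hA => Finset.disjoint_left.mp hd hA hv.2]⟩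

lemma IsComp.reach (hC : IsComp G C) (h3 : c₃ < C.card) (h : Realizes G C c₀ c₁ c₂ c₃) :
    Reach G C c₀ c₁ c₂ c₃ := by
  obtain ⟨H, hle, hc⟩ := h
  refine ⟨H, hle, fun W hW hne hcl => ?_, hc⟩
  rw [hC.2.2 W hW hne hcl]
  by_contra! h
  have := hc.2.2.2
  rw [cnt, Finset.filter_true_of_mem h] at this
  omega

lemma Good.realizes_of_card (hG : ∀ v, nDeg G v = 3) (hA : IsClosedIn G A) (h : Good G A)
    {q : ℕ} (hq : A.card = 4 * q + 2) :
    Realizes G A q (q + 1) q (q + 1) ∧ Realizes G A (q + 1) q (q + 1) q := by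
  obtain ⟨a₀, a₁, a₂, a₃, ha, ha0, ha1, ha2, ha3⟩ := h.realizes
  have hAc := ha.sum_eq hG
  obtain ⟨e, he⟩ := ha.even hG hA
  obtain ⟨rfl, rfl, rfl, rfl⟩ | ⟨rfl, rfl, rfl, rfl⟩ :
      (a₀ = q ∧ a₁ = q + 1 ∧ a₂ = q ∧ a₃ = q + 1) ∨
      (a₀ = q + 1 ∧ a₁ = q ∧ a₂ = q + 1 ∧ a₃ = q) := by omega
  · exact ⟨ha, ha.compl hG⟩
  · exact ⟨ha.compl hG, ha⟩

lemma Good.union [DecidableEq V] (hG : ∀ v, nDeg G v = 3) (hA : IsClosedIn G A)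
    (hB : IsClosedIn G B) (hd : Disjoint A B) (h : Good G A) (h' : Good G B) :
    Good G (A ∪ B) := by
  have key : ∀ S, IsClosedIn G S → Good G S → ∃ q, Realizes G S q q q q ∨
      (Realizes G S q (q + 1) q (q + 1) ∧ Realizes G S (q + 1) q (q + 1) q) := by
    intro S hS hgood
    obtain ⟨i, hi⟩ := hS.even_card hG
    obtain ⟨q, hq | hq⟩ : ∃ q, S.card = 4 * q ∨ S.card = 4 * q + 2 := ⟨S.card / 4, by omega⟩
    · obtain ⟨a₀, a₁, a₂, a₃, ha, ha0, ha1, ha2, ha3⟩ := hgood.realizes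
      obtain ⟨rfl, rfl, rfl, rfl⟩ : a₀ = q ∧ a₁ = q ∧ a₂ = q ∧ a₃ = q := by omega
      exact ⟨_, Or.inl ha⟩
    · exact ⟨q, Or.inr (hgood.realizes_of_card hG hS hq)⟩
  obtain ⟨p, hp⟩ := key A hA h
  obtain ⟨q, hq⟩ := key B hB h'
  rcases hp with hp | hp <;> rcases hq with hq | hq
  · exact (hp.union hA hd hq).good hG (p + q) (by omega) (by omega) (by omega) (by omega)
  · exact (hp.union hA hd hq.1).good hG (p + q) (by omega) (by omega) (by omega) (by omega)
  · exact (hp.1.union hA hd hq).good hG (p + q) (by omega) (by omega) (by omega) (by omega)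
  · exact (hp.1.union hA hd hq.2).good hG (p + q + 1) (by omega) (by omega) (by omega) (by omega)

end Realizes

section SmallDeletions

variable {V : Type*} [Fintype V] {G H H' : SimpleGraph V} {C S T A B : Finset V}
  {a b c d e s t v w y : V}

lemma cnt_self (hG : ∀ v, nDeg G v = 3) (S : Finset V) (k : ℕ) :
    cnt S G k = if k = 3 then S.card else 0 := by
  unfold cnt
  split_ifs with h
  · rw [Finset.filter_true_of_mem fun v _ => (hG v).trans h.symm]
  · rw [Finset.filter_false_of_mem fun v _ => by rw [hG v]; exact Ne.symm h, Finset.card_empty]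

lemma realizes_self (hG : ∀ v, nDeg G v = 3) (S : Finset V) : Realizes G S 0 0 0 S.card :=
  ⟨G, le_rfl, by simp [cnt_self hG], by simp [cnt_self hG], by simp [cnt_self hG],
    by simp [cnt_self hG]⟩

lemma realizes_delete_edge (hG : ∀ v, nDeg G v = 3) (hS : IsClosedIn G S) (hne : S.Nonempty) :
    Realizes G S 0 0 2 (S.card - 2) := by
  obtain ⟨a, ha⟩ := hne
  obtain ⟨b, hab⟩ := exists_adj (H := G) (v := a) (by rw [hG]; omega)
  obtain ⟨H, hle, -, d1, d2, -, k⟩ := delete_edge (S := S) le_rfl hab ha (hS a ha b hab)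
  simp only [hG, cnt_self hG] at d1 d2 k
  obtain ⟨e1, e2⟩ : nDeg H a = 2 ∧ nDeg H b = 2 := by omega
  simp only [e1, e2] at k
  refine ⟨H, hle, ?_, ?_, ?_, ?_⟩
  · simpa using k 0
  · simpa using k 1
  · simpa using k 2
  · have := k 3
    simp at this
    omega

lemma realizes_delete_path_two (hG : ∀ v, nDeg G v = 3) (hS : IsClosedIn G S) (hne : S.Nonempty) :
    Realizes G S 0 1 2 (S.card - 3) := by
  obtain ⟨b, hb⟩ := hne
  obtain ⟨a, hba⟩ := exists_adj (H := G) (v := b) (by rw [hG]; omega)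
  obtain ⟨c, hca, hbc⟩ := exists_adj_ne (H := G) (v := b) a (by rw [hG]; omega)
  have ha := hS b hb a hba
  have hc := hS b hb c hbc
  obtain ⟨H, hle, i, d1, d2, u, k⟩ := delete_edge (S := S) le_rfl hba hb ha
  have hbc' : H.Adj b c := (i b c).mpr ⟨hbc, fun h => hca h.2, fun h => hba.ne h.1⟩
  obtain ⟨H', hle', -, d1', d2', -, k'⟩ := delete_edge (S := S) hle hbc' hb hc
  have u1 := (u c).resolve_left hbc.ne' |>.resolve_left hca
  simp only [hG, cnt_self hG] at d1 d2 k u1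
  obtain ⟨e1, e2⟩ : nDeg H b = 2 ∧ nDeg H a = 2 := by omega
  rw [e1] at d1'
  rw [u1] at d2'
  obtain ⟨e1', e2'⟩ : nDeg H' b = 1 ∧ nDeg H' c = 2 := by omega
  simp only [e1, e2, u1, e1', e2'] at k k'
  refine ⟨H', hle', ?_, ?_, ?_, ?_⟩
  · have := k 0; have := k' 0; simp_all
  · have := k 1; have := k' 1; simp_all
  · have := k 2; have := k' 2; simp at *; omega
  · have := k 3; have := k' 3; simp at *; omega

lemma realizes_delete_path_three (hG : ∀ v, nDeg G v = 3) (hS : IsClosedIn G S) (hne : S.Nonempty) :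
    Realizes G S 0 2 2 (S.card - 4) := by
  obtain ⟨b, hb⟩ := hne
  obtain ⟨c, hbc⟩ := exists_adj (H := G) (v := b) (by rw [hG]; omega)
  obtain ⟨a, hac, hba⟩ := exists_adj_ne (H := G) (v := b) c (by rw [hG]; omega)
  obtain ⟨d, hda, hdb, hcd⟩ := exists_adj_ne_ne (H := G) (v := c) a b (by rw [hG]; omega)
  have ha := hS b hb a hba
  have hc := hS b hb c hbc
  have hd := hS c hc d hcd
  obtain ⟨H, hle, i, d1, d2, u, k⟩ := delete_edge (S := S) le_rfl hbc hb hc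
  have hba' : H.Adj b a := (i b a).mpr ⟨hba, fun h => hac h.2, fun h => hbc.ne h.1⟩
  have hcd' : H.Adj c d := (i c d).mpr ⟨hcd, fun h => hbc.ne h.1.symm, fun h => hdb h.2⟩
  obtain ⟨H', hle', i', d1', d2', u', k'⟩ := delete_edge (S := S) hle hba' hb ha
  have hcd'' : H'.Adj c d :=
    (i' c d).mpr ⟨hcd', fun h => hbc.ne h.1.symm, fun h => hac h.1.symm⟩
  obtain ⟨H'', hle'', -, d1'', d2'', -, k''⟩ := delete_edge (S := S) hle' hcd'' hc hd
  have u1 := (u a).resolve_left hba.ne' |>.resolve_left hac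
  have u2 := (u d).resolve_left hdb |>.resolve_left hcd.ne'
  have u3 := (u' c).resolve_left hbc.ne' |>.resolve_left hac.symm
  have u4 := (u' d).resolve_left hdb |>.resolve_left hda
  simp only [hG, cnt_self hG] at d1 d2 k u1 u2
  obtain ⟨e1, e2⟩ : nDeg H b = 2 ∧ nDeg H c = 2 := by omega
  rw [e1] at d1'
  rw [u1] at d2'
  rw [e2] at u3
  rw [u2] at u4
  rw [u3] at d1''
  rw [u4] at d2''
  obtain ⟨e1', e2'⟩ : nDeg H' b = 1 ∧ nDeg H' a = 2 := by omega
  obtain ⟨e1'', e2''⟩ : nDeg H'' c = 1 ∧ nDeg H'' d = 2 := by omega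
  simp only [e1, e2, u1, e1', e2', u3, u4, e1'', e2''] at k k' k''
  refine ⟨H'', hle'', ?_, ?_, ?_, ?_⟩
  · have := k 0; have := k' 0; have := k'' 0; simp at *; omega
  · have := k 1; have := k' 1; have := k'' 1; simp at *; omega
  · have := k 2; have := k' 2; have := k'' 2; simp at *; omega
  · have := k 3; have := k' 3; have := k'' 3; simp at *; omega

/-- Delete the edges at `s`, and one more edge `a e`; here `e` need not be distinct from the other
neighbors `b`, `c` of `s`. -/
lemma realizes_delete_star (hG : ∀ v, nDeg G v = 3) (hS : IsClosedIn G S) (hs : s ∈ S)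
    (ha : G.Adj s a) (hb : G.Adj s b) (hc : G.Adj s c) (hab : a ≠ b) (hac : a ≠ c) (hbc : b ≠ c)
    (he : G.Adj a e) (hes : e ≠ s) :
    (e = b ∨ e = c → Realizes G S 1 2 1 (S.card - 4)) ∧
    (e ≠ b → e ≠ c → Realizes G S 1 1 3 (S.card - 5)) := by
  have haS := hS s hs a ha
  have hbS := hS s hs b hb
  have hcS := hS s hs c hc
  have heS := hS a haS e he
  obtain ⟨H₁, l₁, i₁, p₁, q₁, u₁, k₁⟩ := delete_edge (S := S) le_rfl ha hs haS
  have hb₁ : H₁.Adj s b := (i₁ s b).mpr ⟨hb, fun h => hab h.2.symm, fun h => ha.ne h.1⟩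
  have hc₁ : H₁.Adj s c := (i₁ s c).mpr ⟨hc, fun h => hac h.2.symm, fun h => ha.ne h.1⟩
  have he₁ : H₁.Adj a e := (i₁ a e).mpr ⟨he, fun h => ha.ne h.1.symm, fun h => hes h.2⟩
  obtain ⟨H₂, l₂, i₂, p₂, q₂, u₂, k₂⟩ := delete_edge (S := S) l₁ hb₁ hs hbS
  have hc₂ : H₂.Adj s c := (i₂ s c).mpr ⟨hc₁, fun h => hbc h.2.symm, fun h => hb.ne h.1⟩
  have he₂ : H₂.Adj a e := (i₂ a e).mpr ⟨he₁, fun h => ha.ne h.1.symm, fun h => hes h.2⟩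
  obtain ⟨H₃, l₃, i₃, p₃, q₃, u₃, k₃⟩ := delete_edge (S := S) l₂ hc₂ hs hcS
  have he₃ : H₃.Adj a e := (i₃ a e).mpr ⟨he₂, fun h => ha.ne h.1.symm, fun h => hes h.2⟩
  obtain ⟨H₄, l₄, i₄, p₄, q₄, u₄, k₄⟩ := delete_edge (S := S) l₃ he₃ haS heS
  have s1 := (u₁ b).resolve_left hb.ne' |>.resolve_left hab.symm
  have s2 := (u₁ c).resolve_left hc.ne' |>.resolve_left hac.symm
  have s3 := (u₂ c).resolve_left hc.ne' |>.resolve_left hbc.symm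
  have s4 := (u₂ a).resolve_left ha.ne' |>.resolve_left hab
  have s5 := (u₃ a).resolve_left ha.ne' |>.resolve_left hac
  have s6 := (u₃ b).resolve_left hb.ne' |>.resolve_left hbc
  simp only [hG, cnt_self hG] at p₁ q₁ k₁ s1 s2
  have t1 : nDeg H₁ s = 2 := by omega
  have t2 : nDeg H₂ s = 1 := by omega
  have t3 : nDeg H₃ s = 0 := by omega
  have t4 : nDeg H₁ a = 2 := by omega
  have t5 : nDeg H₂ a = 2 := by omega
  have t6 : nDeg H₃ a = 2 := by omega
  have t7 : nDeg H₂ b = 2 := by omega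
  have t8 : nDeg H₂ c = 3 := by omega
  have t9 : nDeg H₃ b = 2 := by omega
  have t10 : nDeg H₃ c = 2 := by omega
  have t11 : nDeg H₄ a = 1 := by omega
  simp only [s1, t1, t2, t3, t4, t6, t7, t8, t10, t11] at k₁ k₂ k₃ k₄
  refine ⟨fun h => ⟨H₄, l₄, ?_⟩, fun heb hec => ⟨H₄, l₄, ?_⟩⟩
  · have v1 : nDeg H₃ e = 2 := by
      rcases h with rfl | rfl
      exacts [t9, t10]
    rw [v1] at q₄
    have v2 : nDeg H₄ e = 1 := by omega
    simp only [v1, v2] at k₄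
    refine ⟨?_, ?_, ?_, ?_⟩
    · have := k₁ 0; have := k₂ 0; have := k₃ 0; have := k₄ 0; simp at *; omega
    · have := k₁ 1; have := k₂ 1; have := k₃ 1; have := k₄ 1; simp at *; omega
    · have := k₁ 2; have := k₂ 2; have := k₃ 2; have := k₄ 2; simp at *; omega
    · have := k₁ 3; have := k₂ 3; have := k₃ 3; have := k₄ 3; simp at *; omega
  · have v1 : nDeg H₃ e = 3 := by
      rw [(u₃ e).resolve_left hes |>.resolve_left hec, (u₂ e).resolve_left hes |>.resolve_left heb,
        (u₁ e).resolve_left hes |>.resolve_left he.ne', hG]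
    rw [v1] at q₄
    have v2 : nDeg H₄ e = 2 := by omega
    simp only [v1, v2] at k₄
    refine ⟨?_, ?_, ?_, ?_⟩
    · have := k₁ 0; have := k₂ 0; have := k₃ 0; have := k₄ 0; simp at *; omega
    · have := k₁ 1; have := k₂ 1; have := k₃ 1; have := k₄ 1; simp at *; omega
    · have := k₁ 2; have := k₂ 2; have := k₃ 2; have := k₄ 2; simp at *; omega
    · have := k₁ 3; have := k₂ 3; have := k₃ 3; have := k₄ 3; simp at *; omega

end SmallDeletions

section SmallComponents

variable {V : Type*} [Fintype V] {G H H' : SimpleGraph V} {C S T A B : Finset V}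
  {a b c d e s t v w y : V}

lemma exists_three_adj (h : nDeg G s = 3) : ∃ a b c, a ≠ b ∧ a ≠ c ∧ b ≠ c ∧
    ∀ w, G.Adj s w ↔ w = a ∨ w = b ∨ w = c := by
  obtain ⟨a, b, c, hab, hac, hbc, h⟩ := Set.ncard_eq_three.mp h
  refine ⟨a, b, c, hab, hac, hbc, fun w => ?_⟩
  rw [← SimpleGraph.mem_neighborSet, h]
  simp

lemma adj_of_card_four (hG : ∀ v, nDeg G v = 3) (hS : IsClosedIn G S) (h4 : S.card = 4)
    (hv : v ∈ S) (hw : w ∈ S) (hvw : v ≠ w) : G.Adj v w := by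
  classical
  have h1 := card_nbrsIn_eq hS hv
  have h2 : nbrsIn G S v = S.erase v := by
    refine Finset.eq_of_subset_of_card_le (fun x hx => ?_) ?_
    · obtain ⟨h, h'⟩ := mem_nbrsIn.mp hx
      exact Finset.mem_erase.mpr ⟨h'.ne', h⟩
    · rw [Finset.card_erase_of_mem hv, h4, h1, hG]
  have h3 : w ∈ nbrsIn G S v := h2 ▸ Finset.mem_erase.mpr ⟨hvw.symm, hw⟩
  exact (mem_nbrsIn.mp h3).2

lemma realizes_of_triangle (hG : ∀ v, nDeg G v = 3) (hS : IsClosedIn G S) (hs : s ∈ S)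
    (ha : G.Adj s a) (hb : G.Adj s b) (hab : G.Adj a b) : Realizes G S 1 2 1 (S.card - 4) := by
  obtain ⟨c, hca, hcb, hc⟩ := exists_adj_ne_ne (H := G) (v := s) a b (by rw [hG]; omega)
  exact (realizes_delete_star hG hS hs ha hb hc hab.ne hca.symm hcb.symm hab hb.ne').1 (Or.inl rfl)

lemma realizes_of_card_four (hG : ∀ v, nDeg G v = 3) (hS : IsClosedIn G S) (h4 : S.card = 4) :
    Realizes G S 1 2 1 0 := by
  obtain ⟨s, hs⟩ := Finset.card_pos.mp (by omega : 0 < S.card)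
  obtain ⟨a, b, c, hab, -, -, h⟩ := exists_three_adj (hG s)
  have ha := (h a).mpr (by simp)
  have hb := (h b).mpr (by simp)
  simpa [h4] using realizes_of_triangle hG hS hs ha hb
    (adj_of_card_four hG hS h4 (hS s hs a ha) (hS s hs b hb) hab)

lemma IsComp.realizes (hG : ∀ v, nDeg G v = 3) (hC : IsComp G C) (h6 : 6 ≤ C.card) :
    Realizes G C 1 1 3 (C.card - 5) := by
  classical
  obtain ⟨s, hs⟩ := hC.1
  obtain ⟨a, b, c, hab, hac, hbc, h⟩ := exists_three_adj (hG s)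
  have ha := (h a).mpr (by simp)
  have hb := (h b).mpr (by simp)
  have hc := (h c).mpr (by simp)
  obtain ⟨x, hx, e, hxe, he⟩ : ∃ x, G.Adj s x ∧ ∃ e, G.Adj x e ∧ e ∉ ({s, a, b, c} : Finset V) := by
    by_contra! hcon
    have hcl : IsClosedIn G {s, a, b, c} := by
      intro v hv w hw
      rw [Finset.mem_insert] at hv
      rcases hv with rfl | hv
      · have := (h w).mp hw
        simp [this]
      · exact hcon v ((h v).mpr (by simpa using hv)) w hw
    have hsub : ({s, a, b, c} : Finset V) ⊆ C := by
      intro v hv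
      rw [Finset.mem_insert] at hv
      rcases hv with rfl | hv
      · exact hs
      · exact hC.2.1 s hs v ((h v).mpr (by simpa using hv))
    have h1 := hC.2.2 _ hsub ⟨s, by simp⟩ hcl
    have h2 := Finset.card_le_four (a := s) (b := a) (c := b) (d := c)
    rw [h1] at h2
    omega
  simp only [Finset.mem_insert, Finset.mem_singleton, not_or] at he
  obtain ⟨hes, hea, heb, hec⟩ := he
  rcases (h x).mp hx with rfl | rfl | rfl
  · exact (realizes_delete_star hG hC.2.1 hs ha hb hc hab hac hbc hxe hes).2 heb hec
  · exact (realizes_delete_star hG hC.2.1 hs hb ha hc hab.symm hbc hac hxe hes).2 hea hec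
  · exact (realizes_delete_star hG hC.2.1 hs hc ha hb hac.symm hbc.symm hab hxe hes).2 hea heb

lemma nonempty_iso_K4 (hG : ∀ v, nDeg G v = 3) (h4 : Fintype.card V = 4) :
    Nonempty (G ≃g K4) := by
  refine ⟨⟨Fintype.equivFinOfCardEq h4, fun {v w} => ?_⟩⟩
  simp only [K4, SimpleGraph.completeGraph, SimpleGraph.top_adj, ne_eq,
    EmbeddingLike.apply_eq_iff_eq]
  exact ⟨fun h => adj_of_card_four hG (S := Finset.univ) (fun _ _ _ _ => Finset.mem_univ _)
    (by simpa using h4) (Finset.mem_univ _) (Finset.mem_univ _) h, fun h => h.ne⟩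

lemma nonempty_iso_K33 (hG : ∀ v, nDeg G v = 3) (h6 : Fintype.card V = 6)
    (htri : ∀ x y z, G.Adj x y → G.Adj x z → ¬ G.Adj y z) : Nonempty (G ≃g K33) := by
  classical
  have hU : IsClosedIn G Finset.univ := fun _ _ _ _ => Finset.mem_univ _
  obtain ⟨s⟩ : Nonempty V := Fintype.card_pos_iff.mp (by omega)
  set A := nbrsIn G Finset.univ s with hA
  have hmem : ∀ x, x ∈ A ↔ G.Adj s x := fun x => by simp [hA, mem_nbrsIn]
  have hAc : A.card = 3 := (card_nbrsIn_eq hU (Finset.mem_univ s)).trans (hG s)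
  have hAc' : Aᶜ.card = 3 := by rw [Finset.card_compl, h6, hAc]
  have h1 : ∀ x ∈ A, nbrsIn G Finset.univ x = Aᶜ := by
    intro x hx
    refine Finset.eq_of_subset_of_card_le (fun y hy => ?_) ?_
    · rw [Finset.mem_compl, hmem]
      exact fun h => htri s x y ((hmem x).mp hx) h (mem_nbrsIn.mp hy).2
    · rw [hAc', card_nbrsIn_eq hU (Finset.mem_univ x), hG]
  have h1' : ∀ x ∈ A, ∀ y, G.Adj x y ↔ y ∉ A := fun x hx y => by
    rw [← Finset.mem_compl, ← h1 x hx, mem_nbrsIn]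
    simp
  have h2 : ∀ x ∉ A, ∀ y, G.Adj x y → y ∈ A := by
    intro x hx y hxy
    by_contra hy
    obtain ⟨z, hz⟩ := Finset.card_pos.mp (by omega : 0 < A.card)
    exact htri z x y ((h1' z hz x).mpr hx) ((h1' z hz y).mpr hy) hxy
  let f : V ≃ Fin 3 ⊕ Fin 3 := (Equiv.sumCompl (· ∈ A)).symm.trans
    (Equiv.sumCongr (Fintype.equivFinOfCardEq (by simpa using hAc))
      (Fintype.equivFinOfCardEq (by
        rw [Fintype.card_subtype_compl]
        simp [h6, hAc])))
  have hl : ∀ x, x ∈ A → (f x).isLeft := fun x hx => by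
    simp [f, Equiv.sumCompl_symm_apply_of_pos (p := (· ∈ A)) hx]
  have hr : ∀ x, x ∉ A → (f x).isRight := fun x hx => by
    simp [f, Equiv.sumCompl_symm_apply_of_neg (p := (· ∈ A)) hx]
  refine ⟨⟨f, fun {x y} => ?_⟩⟩
  simp only [K33, completeBipartiteGraph]
  by_cases hx : x ∈ A <;> by_cases hy : y ∈ A
  · have := hl x hx
    have := hl y hy
    simp_all
  · have := hl x hx
    have := hr y hy
    simp_all
  · have := hr x hx
    have := hl y hy
    have : G.Adj x y := ((h1' y hy x).mpr hx).symm
    simp_all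
  · have := hr x hx
    have := hr y hy
    have : ¬ G.Adj x y := fun h => hy (h2 x hx y h)
    simp_all

lemma nonempty_iso_unionK4 {m : ℕ} (f : V → Fin m) (hf : ∀ i, Fintype.card {v // f v = i} = 4)
    (hadj : ∀ v w, G.Adj v w ↔ v ≠ w ∧ f v = f w) : Nonempty (G ≃g unionK4 m) := by
  let g : V ≃ Fin m × Fin 4 := (Equiv.sigmaFiberEquiv f).symm.trans
    (Equiv.sigmaEquivProdOfEquiv fun i => Fintype.equivFinOfCardEq (hf i))
  have hg : ∀ v, (g v).1 = f v := fun v => rfl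
  refine ⟨⟨g, fun {v w} => ?_⟩⟩
  rw [unionK4, SimpleGraph.fromRel_adj, hg, hg, hadj, g.injective.ne_iff,
    eq_comm (a := f w), or_self]

end SmallComponents

section Unions

variable {V : Type*} [Fintype V] [DecidableEq V] {G : SimpleGraph V} {A B C D E S R : Finset V}

lemma good_four_four (hG : ∀ v, nDeg G v = 3) (hA : IsClosedIn G A) (hB : IsClosedIn G B)
    (hAc : A.card = 4) (hBc : B.card = 4) (hAB : Disjoint A B) : Good G (A ∪ B) := by
  have h1 : Realizes G A 0 0 2 2 := by
    simpa [hAc] using realizes_delete_edge hG hA (Finset.card_pos.mp (by omega))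
  have h2 : Realizes G B 0 0 2 2 := by
    simpa [hBc] using realizes_delete_edge hG hB (Finset.card_pos.mp (by omega))
  exact (h1.union hA hAB (h2.compl hG)).good hG 2 (by simp) (by simp) (by simp) (by simp)

lemma good_four_six (hG : ∀ v, nDeg G v = 3) (hA : IsClosedIn G A) (hB : IsClosedIn G B)
    (hAc : A.card = 4) (hBc : B.card = 6) (hAB : Disjoint A B) : Good G (A ∪ B) := by
  have h1 : Realizes G A 0 0 2 2 := by
    simpa [hAc] using realizes_delete_edge hG hA (Finset.card_pos.mp (by omega))
  have h2 : Realizes G B 0 1 2 3 := by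
    simpa [hBc] using realizes_delete_path_two hG hB (Finset.card_pos.mp (by omega))
  exact ((h1.compl hG).union hA hAB h2).good hG 2 (by simp) (by simp) (by simp) (by simp)

lemma good_six_six (hG : ∀ v, nDeg G v = 3) (hA : IsClosedIn G A) (hB : IsClosedIn G B)
    (hAc : A.card = 6) (hBc : B.card = 6) (hAB : Disjoint A B) : Good G (A ∪ B) := by
  have h1 : Realizes G A 0 1 2 3 := by
    simpa [hAc] using realizes_delete_path_two hG hA (Finset.card_pos.mp (by omega))
  have h2 : Realizes G B 0 1 2 3 := by
    simpa [hBc] using realizes_delete_path_two hG hB (Finset.card_pos.mp (by omega))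
  exact ((h1.compl hG).union hA hAB h2).good hG 3 (by simp) (by simp) (by simp) (by simp)

lemma good_four_four_six (hG : ∀ v, nDeg G v = 3) (hA : IsClosedIn G A) (hB : IsClosedIn G B)
    (hC : IsClosedIn G C) (hAc : A.card = 4) (hBc : B.card = 4) (hCc : C.card = 6)
    (hAB : Disjoint A B) (hAC : Disjoint A C) (hBC : Disjoint B C) : Good G (A ∪ B ∪ C) := by
  have h1 : Realizes G A 4 0 0 0 := by
    simpa [hAc] using (realizes_self hG A).compl hG
  have h2 : Realizes G B 0 2 2 0 := by
    simpa [hBc] using realizes_delete_path_three hG hB (Finset.card_pos.mp (by omega))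
  have h3 : Realizes G C 0 1 2 3 := by
    simpa [hCc] using realizes_delete_path_two hG hC (Finset.card_pos.mp (by omega))
  exact ((h1.union hA hAB h2).union (hA.union hB) (Finset.disjoint_union_left.mpr ⟨hAC, hBC⟩)
    h3).good hG 3 (by simp) (by simp) (by simp) (by simp)

lemma good_four_six_six (hG : ∀ v, nDeg G v = 3) (hA : IsClosedIn G A) (hB : IsClosedIn G B)
    (hC : IsClosedIn G C) (hAc : A.card = 4) (hBc : B.card = 6) (hCc : C.card = 6)
    (hAB : Disjoint A B) (hAC : Disjoint A C) (hBC : Disjoint B C) : Good G (A ∪ B ∪ C) := by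
  have h1 : Realizes G A 4 0 0 0 := by
    simpa [hAc] using (realizes_self hG A).compl hG
  have h2 : Realizes G B 0 2 2 2 := by
    simpa [hBc] using realizes_delete_path_three hG hB (Finset.card_pos.mp (by omega))
  have h3 : Realizes G C 0 2 2 2 := by
    simpa [hCc] using realizes_delete_path_three hG hC (Finset.card_pos.mp (by omega))
  exact ((h1.union hA hAB h2).union (hA.union hB) (Finset.disjoint_union_left.mpr ⟨hAC, hBC⟩)
    h3).good hG 4 (by simp) (by simp) (by simp) (by simp)

lemma good_six_six_six (hG : ∀ v, nDeg G v = 3) (hA : IsClosedIn G A) (hB : IsClosedIn G B)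
    (hC : IsClosedIn G C) (hAc : A.card = 6) (hBc : B.card = 6) (hCc : C.card = 6)
    (hAB : Disjoint A B) (hAC : Disjoint A C) (hBC : Disjoint B C) : Good G (A ∪ B ∪ C) := by
  have h1 : Realizes G A 4 2 0 0 := by
    simpa [hAc] using (realizes_delete_edge hG hA (Finset.card_pos.mp (by omega))).compl hG
  have h2 : Realizes G B 0 2 2 2 := by
    simpa [hBc] using realizes_delete_path_three hG hB (Finset.card_pos.mp (by omega))
  have h3 : Realizes G C 0 1 2 3 := by
    simpa [hCc] using realizes_delete_path_two hG hC (Finset.card_pos.mp (by omega))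
  exact ((h1.union hA hAB h2).union (hA.union hB) (Finset.disjoint_union_left.mpr ⟨hAC, hBC⟩)
    h3).good hG 4 (by simp) (by simp) (by simp) (by simp)

lemma good_of_five_fours (hG : ∀ v, nDeg G v = 3) (hA : IsClosedIn G A) (hB : IsClosedIn G B)
    (hC : IsClosedIn G C) (hD : IsClosedIn G D) (hE : IsClosedIn G E) (hAc : A.card = 4)
    (hBc : B.card = 4) (hCc : C.card = 4) (hDc : D.card = 4) (hEc : E.card = 4)
    (hAB : Disjoint A B) (hC' : Disjoint (A ∪ B) C) (hD' : Disjoint (A ∪ B ∪ C) D)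
    (hE' : Disjoint (A ∪ B ∪ C ∪ D) E) : Good G (A ∪ B ∪ C ∪ D ∪ E) := by
  have h1 : Realizes G A 0 0 0 4 := by simpa [hAc] using realizes_self hG A
  have h2 : Realizes G B 4 0 0 0 := by simpa [hBc] using (realizes_self hG B).compl hG
  have h3 := realizes_of_card_four hG hC hCc
  have h4 : Realizes G D 0 1 2 1 := by
    simpa [hDc] using realizes_delete_path_two hG hD (Finset.card_pos.mp (by omega))
  have h5 : Realizes G E 0 2 2 0 := by
    simpa [hEc] using realizes_delete_path_three hG hE (Finset.card_pos.mp (by omega))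
  exact ((((h1.union hA hAB h2).union (hA.union hB) hC' h3).union ((hA.union hB).union hC) hD'
    h4).union (((hA.union hB).union hC).union hD) hE' h5).good hG 5
    (by simp) (by simp) (by simp) (by simp)

lemma good_large_four (hG : ∀ v, nDeg G v = 3) (hC : IsComp G C) (hA : IsComp G A)
    (hCc : 8 ≤ C.card) (hAc : A.card = 4) (hd : Disjoint C A) : Good G (C ∪ A) := by
  have h1 : Realizes G A 2 2 0 0 := by
    simpa [hAc] using (realizes_delete_edge hG hA.2.1 hA.1).compl hG
  have hr := (hC.reach (by omega) (hC.realizes hG (by omega))).union hC.2.1 hA.2.1 hd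
    (hA.reach (by omega) h1)
  obtain ⟨i, hi⟩ := hC.2.1.even_card hG
  exact (good_of_reach_aux hG (hC.2.1.union hA.2.1) (C.card - 5) 3).1 (by omega) (by omega) hr

lemma good_large_six (hG : ∀ v, nDeg G v = 3) (hC : IsComp G C) (hA : IsComp G A)
    (hCc : 8 ≤ C.card) (hAc : A.card = 6) (hd : Disjoint C A) : Good G (C ∪ A) := by
  have h1 : Realizes G A 3 2 1 0 := by
    simpa [hAc] using (realizes_delete_path_two hG hA.2.1 hA.1).compl hG
  have hr := (hC.reach (by omega) (hC.realizes hG (by omega))).union hC.2.1 hA.2.1 hd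
    (hA.reach (by omega) h1)
  obtain ⟨i, hi⟩ := hC.2.1.even_card hG
  exact (good_of_reach_aux hG (hC.2.1.union hA.2.1) (C.card - 5) 3).2.2 (by omega) (by omega) hr

/-- `S` is the vertex set of a disjoint union of three copies of `K₄`. -/
def IsTripleK4 (G : SimpleGraph V) (S : Finset V) : Prop :=
  ∃ A B C, (IsComp G A ∧ A.card = 4) ∧ (IsComp G B ∧ B.card = 4) ∧ (IsComp G C ∧ C.card = 4) ∧
    Disjoint A B ∧ Disjoint A C ∧ Disjoint B C ∧ S = A ∪ B ∪ C

/-- `S` is balanced, or one of the potential exceptions. -/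
def Almost (G : SimpleGraph V) (S : Finset V) : Prop :=
  Good G S ∨ (IsComp G S ∧ S.card = 4) ∨ (IsComp G S ∧ S.card = 6) ∨ IsTripleK4 G S

lemma Almost.union_large (hG : ∀ v, nDeg G v = 3) (hC : IsComp G C) (hR : IsClosedIn G R)
    (hCc : 8 ≤ C.card) (hd : Disjoint C R) (h : Almost G R) : Good G (C ∪ R) := by
  obtain h | ⟨h, h4⟩ | ⟨h, h6⟩ | h := h
  · exact (hC.good hG hCc).union hG hC.2.1 hR hd h
  · exact good_large_four hG hC h hCc h4 hd
  · exact good_large_six hG hC h hCc h6 hd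
  · obtain ⟨A, B, D, ⟨hA, hAc⟩, ⟨hB, hBc⟩, ⟨hD, hDc⟩, hAB, hAD, hBD, rfl⟩ := h
    simp only [Finset.disjoint_union_right] at hd
    have : C ∪ (A ∪ B ∪ D) = (C ∪ A) ∪ (B ∪ D) := by ac_rfl
    rw [this]
    refine (good_large_four hG hC hA hCc hAc hd.1.1).union hG (hC.2.1.union hA.2.1)
      (hB.2.1.union hD.2.1) ?_ (good_four_four hG hB.2.1 hD.2.1 hBc hDc hBD)
    simp [hd, hAB, hAD]

lemma Almost.union_four_four (hG : ∀ v, nDeg G v = 3) (hC : IsComp G C) (hD : IsComp G D)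
    (hR : IsClosedIn G R) (hCc : C.card = 4) (hDc : D.card = 4) (hCD : Disjoint C D)
    (hCR : Disjoint C R) (hDR : Disjoint D R) (h : Almost G R) : Almost G (C ∪ D ∪ R) := by
  obtain h | ⟨h, h4⟩ | ⟨h, h6⟩ | h := h
  · exact Or.inl ((good_four_four hG hC.2.1 hD.2.1 hCc hDc hCD).union hG (hC.2.1.union hD.2.1) hR
      (Finset.disjoint_union_left.mpr ⟨hCR, hDR⟩) h)
  · exact Or.inr (Or.inr (Or.inr ⟨C, D, R, ⟨hC, hCc⟩, ⟨hD, hDc⟩, ⟨h, h4⟩, hCD, hCR, hDR, rfl⟩))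
  · exact Or.inl (good_four_four_six hG hC.2.1 hD.2.1 hR hCc hDc h6 hCD hCR hDR)
  · obtain ⟨X, Y, Z, ⟨hX, hXc⟩, ⟨hY, hYc⟩, ⟨hZ, hZc⟩, hXY, hXZ, hYZ, rfl⟩ := h
    simp only [Finset.disjoint_union_right] at hCR hDR
    have : C ∪ D ∪ (X ∪ Y ∪ Z) = C ∪ D ∪ X ∪ Y ∪ Z := by ac_rfl
    rw [this]
    refine Or.inl (good_of_five_fours hG hC.2.1 hD.2.1 hX.2.1 hY.2.1 hZ.2.1 hCc hDc hXc hYc hZc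
      hCD ?_ ?_ ?_) <;> simp [*]

lemma Almost.union_four_six (hG : ∀ v, nDeg G v = 3) (hC : IsComp G C) (hD : IsComp G D)
    (hR : IsClosedIn G R) (hCc : C.card = 4) (hDc : D.card = 6) (hCD : Disjoint C D)
    (hCR : Disjoint C R) (hDR : Disjoint D R) (h : Almost G R) : Good G (C ∪ D ∪ R) := by
  obtain h | ⟨h, h4⟩ | ⟨h, h6⟩ | h := h
  · exact (good_four_six hG hC.2.1 hD.2.1 hCc hDc hCD).union hG (hC.2.1.union hD.2.1) hR
      (Finset.disjoint_union_left.mpr ⟨hCR, hDR⟩) h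
  · rw [Finset.union_right_comm]
    exact good_four_four_six hG hC.2.1 hR hD.2.1 hCc h4 hDc hCR hCD hDR.symm
  · exact good_four_six_six hG hC.2.1 hD.2.1 hR hCc hDc h6 hCD hCR hDR
  · obtain ⟨X, Y, Z, ⟨hX, hXc⟩, ⟨hY, hYc⟩, ⟨hZ, hZc⟩, hXY, hXZ, hYZ, rfl⟩ := h
    simp only [Finset.disjoint_union_right] at hCR hDR
    have : C ∪ D ∪ (X ∪ Y ∪ Z) = (C ∪ X ∪ D) ∪ (Y ∪ Z) := by ac_rfl
    rw [this]
    refine (good_four_four_six hG hC.2.1 hX.2.1 hD.2.1 hCc hXc hDc hCR.1.1 hCD hDR.1.1.symm).union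
      hG ((hC.2.1.union hX.2.1).union hD.2.1) (hY.2.1.union hZ.2.1) ?_
      (good_four_four hG hY.2.1 hZ.2.1 hYc hZc hYZ)
    simp [*]

lemma Almost.union_six_six (hG : ∀ v, nDeg G v = 3) (hC : IsComp G C) (hD : IsComp G D)
    (hR : IsClosedIn G R) (hCc : C.card = 6) (hDc : D.card = 6) (hCD : Disjoint C D)
    (hCR : Disjoint C R) (hDR : Disjoint D R) (h : Almost G R) : Good G (C ∪ D ∪ R) := by
  obtain h | ⟨h, h4⟩ | ⟨h, h6⟩ | h := h
  · exact (good_six_six hG hC.2.1 hD.2.1 hCc hDc hCD).union hG (hC.2.1.union hD.2.1) hR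
      (Finset.disjoint_union_left.mpr ⟨hCR, hDR⟩) h
  · rw [Finset.union_comm, ← Finset.union_assoc]
    exact good_four_six_six hG hR hC.2.1 hD.2.1 h4 hCc hDc hCR.symm hDR.symm hCD
  · exact good_six_six_six hG hC.2.1 hD.2.1 hR hCc hDc h6 hCD hCR hDR
  · obtain ⟨X, Y, Z, ⟨hX, hXc⟩, ⟨hY, hYc⟩, ⟨hZ, hZc⟩, hXY, hXZ, hYZ, rfl⟩ := h
    simp only [Finset.disjoint_union_right] at hCR hDR
    have : C ∪ D ∪ (X ∪ Y ∪ Z) = (X ∪ C ∪ D) ∪ (Y ∪ Z) := by ac_rfl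
    rw [this]
    refine (good_four_six_six hG hX.2.1 hC.2.1 hD.2.1 hXc hCc hDc hCR.1.1.symm hDR.1.1.symm
      hCD).union hG ((hX.2.1.union hC.2.1).union hD.2.1) (hY.2.1.union hZ.2.1) ?_
      (good_four_four hG hY.2.1 hZ.2.1 hYc hZc hYZ)
    simp [*]

lemma exists_isComp (hS : IsClosedIn G S) (hne : S.Nonempty) : ∃ C ⊆ S, IsComp G C := by
  classical
  obtain ⟨C, hC, hmin⟩ := Finset.exists_min_image
    (S.powerset.filter fun C => C.Nonempty ∧ IsClosedIn G C) Finset.card ⟨S, by simp [hne, hS]⟩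
  simp only [Finset.mem_filter, Finset.mem_powerset] at hC hmin
  exact ⟨C, hC.1, hC.2.1, hC.2.2, fun W hW h h' =>
    Finset.eq_of_subset_of_card_le hW (hmin W ⟨hW.trans hC.1, h, h'⟩)⟩

theorem almost_of_isClosedIn (hG : ∀ v, nDeg G v = 3) (hS : IsClosedIn G S) : Almost G S := by
  induction hn : S.card using Nat.strong_induction_on generalizing S with
  | _ n ih =>
  subst hn
  obtain rfl | hne := S.eq_empty_or_nonempty
  · exact Or.inl ((realizes_self hG ∅).good hG 0 (by simp) (by simp) (by simp) (by simp))
  have hrec : ∀ C ⊆ S, IsComp G C → ∀ R ⊆ S, IsClosedIn G R → Disjoint C R → Almost G R := by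
    intro C hCS hC R hRS hR hd
    refine ih _ (Finset.card_lt_card ⟨hRS, fun h => ?_⟩) hR rfl
    obtain ⟨v, hv⟩ := hC.1
    exact Finset.disjoint_left.mp hd hv (h (hCS hv))
  by_cases hlarge : ∃ C ⊆ S, IsComp G C ∧ 8 ≤ C.card
  · obtain ⟨C, hCS, hC, h8⟩ := hlarge
    have hR := hS.sdiff hC.2.1
    rw [← Finset.union_sdiff_of_subset hCS]
    exact Or.inl ((hrec C hCS hC _ Finset.sdiff_subset hR Finset.disjoint_sdiff).union_large hG hC
      hR h8 Finset.disjoint_sdiff)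
  have hcard : ∀ C ⊆ S, IsComp G C → C.card = 4 ∨ C.card = 6 := by
    intro C hCS hC
    have h1 := hC.2.1.four_le_card hG hC.1
    obtain ⟨i, hi⟩ := hC.2.1.even_card hG
    have h2 : ¬ 8 ≤ C.card := fun h => hlarge ⟨C, hCS, hC, h⟩
    omega
  obtain ⟨C, hCS, hC⟩ := exists_isComp hS hne
  have hR := hS.sdiff hC.2.1
  obtain hE | hRne := (S \ C).eq_empty_or_nonempty
  · obtain rfl : C = S := hCS.antisymm (Finset.sdiff_eq_empty_iff_subset.mp hE)
    rcases hcard C hCS hC with h | h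
    · exact Or.inr (Or.inl ⟨hC, h⟩)
    · exact Or.inr (Or.inr (Or.inl ⟨hC, h⟩))
  obtain ⟨D, hDR, hD⟩ := exists_isComp hR hRne
  have hDS := hDR.trans Finset.sdiff_subset
  have hCD : Disjoint C D := Finset.disjoint_sdiff.mono_right hDR
  have hQ := hR.sdiff hD.2.1
  have hCQ : Disjoint C ((S \ C) \ D) := Finset.disjoint_sdiff.mono_right Finset.sdiff_subset
  have hDQ : Disjoint D ((S \ C) \ D) := Finset.disjoint_sdiff
  have hAl := hrec C hCS hC _ (Finset.sdiff_subset.trans Finset.sdiff_subset) hQ hCQ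
  have hSe : S = C ∪ D ∪ ((S \ C) \ D) := by
    rw [Finset.union_assoc, Finset.union_sdiff_of_subset hDR, Finset.union_sdiff_of_subset hCS]
  rw [hSe]
  rcases hcard C hCS hC with hCc | hCc <;> rcases hcard D hDS hD with hDc | hDc
  · exact hAl.union_four_four hG hC hD hQ hCc hDc hCD hCQ hDQ
  · exact Or.inl (hAl.union_four_six hG hC hD hQ hCc hDc hCD hCQ hDQ)
  · rw [Finset.union_comm C D]
    exact Or.inl (hAl.union_four_six hG hD hC hQ hDc hCc hCD.symm hDQ hCQ)
  · exact Or.inl (hAl.union_six_six hG hC hD hQ hCc hDc hCD hCQ hDQ)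

lemma IsTripleK4.nonempty_iso (hG : ∀ v, nDeg G v = 3) (h : IsTripleK4 G Finset.univ) :
    Nonempty (G ≃g unionK4 3) := by
  obtain ⟨A, B, C, ⟨hA, hAc⟩, ⟨hB, hBc⟩, ⟨hC, hCc⟩, hAB, hAC, hBC, hU⟩ := h
  have hmem : ∀ v, v ∈ A ∨ v ∈ B ∨ v ∈ C := fun v => by
    have := Finset.mem_univ v
    rw [hU] at this
    simpa [or_assoc] using this
  rw [Finset.disjoint_left] at hAB hAC hBC
  let X : Fin 3 → Finset V := ![A, B, C]
  have hX : ∀ i, IsClosedIn G (X i) ∧ (X i).card = 4 := by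
    intro i
    fin_cases i
    exacts [⟨hA.2.1, hAc⟩, ⟨hB.2.1, hBc⟩, ⟨hC.2.1, hCc⟩]
  let f : V → Fin 3 := fun v => if v ∈ A then 0 else if v ∈ B then 1 else 2
  have hf : ∀ v i, f v = i ↔ v ∈ X i := by
    intro v i
    have := hmem v
    have := @hAB v
    have := @hAC v
    have := @hBC v
    fin_cases i <;> simp only [f, X] <;> split_ifs <;> simp_all
  refine nonempty_iso_unionK4 f (fun i => ?_) fun v w => ?_
  · rw [← (hX i).2, Fintype.card_subtype]
    congr 1
    ext v
    simp [hf]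
  · have hv := (hf v _).mp rfl
    refine ⟨fun h => ⟨h.ne, ((hf w _).mpr ((hX _).1 v hv w h)).symm⟩, fun h => ?_⟩
    exact adj_of_card_four hG (hX _).1 (hX _).2 hv ((hf w _).mp h.2.symm) h.1

end Unions

theorem stmt0 {V : Type*} [Fintype V] (G : SimpleGraph V)
    (hcubic : ∀ v, nDeg G v = 3)
    (hK4 : ¬ Nonempty (G ≃g K4)) (hK33 : ¬ Nonempty (G ≃g K33))
    (h3K4 : ¬ Nonempty (G ≃g unionK4 3)) :
    ∃ H ≤ G, ∀ k ≤ 3,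
      degCount H k = Fintype.card V / 4 ∨ degCount H k = (Fintype.card V + 3) / 4 := by
  classical
  have hU : IsClosedIn G Finset.univ := fun _ _ _ _ => Finset.mem_univ _
  have hgood : Good G Finset.univ := by
    obtain h | ⟨-, h4⟩ | ⟨-, h6⟩ | h := almost_of_isClosedIn hcubic hU
    · exact h
    · exact absurd (nonempty_iso_K4 hcubic h4) hK4
    · by_contra hbad
      refine hK33 (nonempty_iso_K33 hcubic h6 fun x y z hxy hxz hyz => hbad ?_)
      exact (realizes_of_triangle hcubic hU (Finset.mem_univ x) hxy hxz hyz).good hcubic 1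
        (by simp) (by simp) (by simp) (by omega)
    · exact absurd (h.nonempty_iso hcubic) h3K4
  obtain ⟨H, hle, h⟩ := hgood
  refine ⟨H, hle, fun k hk => ?_⟩
  have hc : degCount H k = cnt Finset.univ H k := by
    rw [degCount, cnt, ← Set.ncard_coe_finset]
    simp
  rw [hc]
  exact h k hk
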